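/- arXiv:1703.07170 — 2 statements merged into one kernel-verified Lean document; each statement's English description precedes it below -/
import Mathlib

section
/- Let x be a chain-point for the chain V_0 ⊊ V_1 ⊊ … ⊊ V_k, and let 2−λ_1 > 2−λ_1−λ_2 > … > 2−λ_1−…−λ_ℓ = 1 be the distinct values among x(δ(V_0)),…,x(δ(V_k)) (so λ_j > 0 and Σ_{j=1}^ℓ λ_j = 1). Then there exist vectors x_1,…,x_ℓ ∈ ℝ^E such that x = Σ_{j=1}^ℓ λ_j·x_j and, for each j = 1,…,ℓ, x_j lies in the convex hull of characteristic vectors of Gao-trees for the subchain consisting of those V_i with x(δ(V_i)) ≤ 2 − λ_1 − … − λ_j. -/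
open Finset
open scoped Classical

variable {V : Type*} [Fintype V]

/-- The set of edges of `G` with one endpoint in `S₁` and the other in `S₂`. -/
noncomputable def cutBetween (G : SimpleGraph V) (S₁ S₂ : Finset V) : Finset (Sym2 V) :=
  G.edgeFinset.filter (fun e => ∃ u v, e = s(u, v) ∧ u ∈ S₁ ∧ v ∈ S₂)

/-- The cut `δ(S)`: edges of `G` with exactly one endpoint in `S`. -/
noncomputable def cut (G : SimpleGraph V) (S : Finset V) : Finset (Sym2 V) :=
  cutBetween G S Sᶜ

/-- `E(S)`: edges of `G` with both endpoints in `S`. -/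
noncomputable def inducedEdges (G : SimpleGraph V) (S : Finset V) : Finset (Sym2 V) :=
  G.edgeFinset.filter (fun e => ∀ v ∈ e, v ∈ S)

/-- `T` is the edge set of a spanning tree of `G`. -/
def IsSpanningTree (G : SimpleGraph V) (T : Finset (Sym2 V)) : Prop :=
  (T : Set (Sym2 V)) ⊆ G.edgeSet ∧ (SimpleGraph.fromEdgeSet (T : Set (Sym2 V))).IsTree

/-- Characteristic vector of a set of edges. -/
noncomputable def chi (T : Finset (Sym2 V)) : Sym2 V → ℝ :=
  fun e => if e ∈ T then 1 else 0

/-- The spanning tree polytope `Sp(G)`. -/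
noncomputable def spanningTreePolytope (G : SimpleGraph V) : Set (Sym2 V → ℝ) :=
  convexHull ℝ {x | ∃ T : Finset (Sym2 V), IsSpanningTree G T ∧ x = chi T}

/-- The level sets `L_i = V_i \ V_{i-1}` of a chain `V_0 ⊊ … ⊊ V_k` (with `V_{-1} = ∅`,
`V_{k+1} = V`). -/
noncomputable def level (Vc : ℕ → Finset V) (k : ℕ) : ℕ → Finset V :=
  fun i => if i = 0 then Vc 0 else if i ≤ k then Vc i \ Vc (i - 1) else Finset.univ \ Vc k

/-- `x` is a chain-point for the chain `V_0 ⊊ … ⊊ V_k`. -/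
def IsChainPoint (G : SimpleGraph V) (Vc : ℕ → Finset V) (k : ℕ) (x : Sym2 V → ℝ) : Prop :=
  x ∈ spanningTreePolytope G ∧
  (∑ e ∈ cut G (Vc 0), x e) = 1 ∧
  (∑ e ∈ cut G (Vc k), x e) = 1 ∧
  (∀ i, 1 ≤ i → i ≤ k - 1 → (∑ e ∈ cut G (Vc i), x e) < 2) ∧
  (∀ i, 1 ≤ i → i ≤ k →
    (∑ v ∈ level Vc k i, ∑ e ∈ cut G {v}, x e) = 2 * ((level Vc k i).card : ℝ))

/-- A Gao-tree for the chain `V_0 ⊊ … ⊊ V_k`: a spanning tree meeting each cut `δ(V_i)`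
in exactly one edge. -/
def IsGaoTree (G : SimpleGraph V) (Vc : ℕ → Finset V) (k : ℕ) (T : Finset (Sym2 V)) : Prop :=
  IsSpanningTree G T ∧ ∀ i ≤ k, (T ∩ cut G (Vc i)).card = 1

/-- A Gao-tree for the subchain of `V_0 ⊊ … ⊊ V_k` given by the index set `I`. -/
def IsGaoTreeOn (G : SimpleGraph V) (Vc : ℕ → Finset V) (I : Finset ℕ)
    (T : Finset (Sym2 V)) : Prop :=
  IsSpanningTree G T ∧ ∀ i ∈ I, (T ∩ cut G (Vc i)).card = 1

/-- `Sp_𝒞(G)`: the convex hull of characteristic vectors of Gao-trees. -/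
noncomputable def gaoPolytope (G : SimpleGraph V) (Vc : ℕ → Finset V) (k : ℕ) :
    Set (Sym2 V → ℝ) :=
  convexHull ℝ {x | ∃ T : Finset (Sym2 V), IsGaoTree G Vc k T ∧ x = chi T}

/-- `F` is the edge set of a spanning tree of the induced subgraph `G(U)`. -/
def IsSpanningTreeOfInduced (G : SimpleGraph V) (U : Finset V) (F : Finset (Sym2 V)) : Prop :=
  (F : Set (Sym2 V)) ⊆ G.edgeSet ∧ (∀ e ∈ F, ∀ v ∈ e, v ∈ U) ∧
  F.card = U.card - 1 ∧
  ∀ u ∈ U, ∀ v ∈ U, (SimpleGraph.fromEdgeSet (F : Set (Sym2 V))).Reachable u v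

/-- The rank of `X` in the cycle matroid of `G`. -/
noncomputable def cycleRank (G : SimpleGraph V) (X : Finset (Sym2 V)) : ℕ :=
  (G.edgeFinset.powerset.filter (fun T => IsSpanningTree G T)).sup (fun T => (T ∩ X).card)

/-- The rank of `X` in the matroid whose bases are the Gao-trees. -/
noncomputable def gaoRank (G : SimpleGraph V) (Vc : ℕ → Finset V) (k : ℕ)
    (X : Finset (Sym2 V)) : ℕ :=
  (G.edgeFinset.powerset.filter (fun T => IsGaoTree G Vc k T)).sup (fun T => (T ∩ X).card)

/-- `x` is a solution of the `s`–`t` path TSP subtour elimination LP. -/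
def IsSubtourLPSolution (G : SimpleGraph V) (s t : V) (x : Sym2 V → ℝ) : Prop :=
  x ∈ spanningTreePolytope G ∧
  (∀ v, v ≠ s → v ≠ t → (∑ e ∈ cut G {v}, x e) = 2) ∧
  (∑ e ∈ cut G {s}, x e) = 1 ∧ (∑ e ∈ cut G {t}, x e) = 1

/-- Rank function of a matroid on a finite ground set, as a function on finsets. -/
noncomputable def mrank {E : Type*} [Fintype E] (M : Matroid E) (X : Finset E) : ℕ :=
  (X.powerset.filter (fun I : Finset E => M.Indep (I : Set E))).sup Finset.card

/-- Convex hull of characteristic vectors of independent sets of a matroid. -/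
noncomputable def indepPolytope {E : Type*} [Fintype E] (M : Matroid E) : Set (E → ℝ) :=
  convexHull ℝ {x | ∃ I : Finset E, M.Indep (I : Set E) ∧
    x = fun e => if e ∈ I then (1 : ℝ) else 0}


set_option linter.unusedSectionVars false

/-! ### Edge vectors and rank -/

/-- The vector `1_u - 1_v` of an edge `uv`, oriented arbitrarily. -/
noncomputable def edgeVec (e : Sym2 V) : V → ℝ :=
  Pi.single e.out.1 1 - Pi.single e.out.2 1

/-- The span of the edge vectors of `F`. -/
noncomputable def edgeSpan (F : Finset (Sym2 V)) : Submodule ℝ (V → ℝ) :=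
  Submodule.span ℝ (edgeVec '' (F : Set (Sym2 V)))

/-- The graphic rank of `F`, as the dimension of the span of its edge vectors. -/
noncomputable def edgeRank (F : Finset (Sym2 V)) : ℕ :=
  Module.finrank ℝ (edgeSpan F)

/-- Vectors supported on `p` whose entries sum to zero. -/
def zeroSumOn (p : Finset V) : Submodule ℝ (V → ℝ) where
  carrier := {w | (∀ v ∉ p, w v = 0) ∧ ∑ v, w v = 0}
  add_mem' := by
    rintro a b ⟨ha, ha'⟩ ⟨hb, hb'⟩
    refine ⟨fun v hv => by simp [ha v hv, hb v hv], ?_⟩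
    simp [Finset.sum_add_distrib, ha', hb']
  zero_mem' := by simp
  smul_mem' := by
    rintro c a ⟨ha, ha'⟩
    refine ⟨fun v hv => by simp [ha v hv], ?_⟩
    simp [← Finset.mul_sum, ha']

theorem edgeVec_mk (u v : V) :
    edgeVec s(u, v) = Pi.single u 1 - Pi.single v 1 ∨
      edgeVec s(u, v) = Pi.single v 1 - Pi.single u 1 := by
  have h : s((s(u, v)).out.1, (s(u, v)).out.2) = s(u, v) := Quot.out_eq _
  rw [Sym2.eq_iff] at h
  unfold edgeVec
  rcases h with ⟨h1, h2⟩ | ⟨h1, h2⟩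
  · left; rw [h1, h2]
  · right; rw [h1, h2]

theorem single_sub_single_mem_edgeSpan {F : Finset (Sym2 V)} {u v : V} (h : s(u, v) ∈ F) :
    (Pi.single u 1 - Pi.single v 1 : V → ℝ) ∈ edgeSpan F := by
  have h1 : edgeVec s(u, v) ∈ edgeSpan F := Submodule.subset_span ⟨_, h, rfl⟩
  rcases edgeVec_mk u v with h2 | h2
  · rwa [← h2]
  · rw [← neg_sub, ← h2]; exact neg_mem h1

theorem edgeSpan_le {F : Finset (Sym2 V)} {K : Submodule ℝ (V → ℝ)}
    (h : ∀ u v, s(u, v) ∈ F → (Pi.single u 1 - Pi.single v 1 : V → ℝ) ∈ K) :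
    edgeSpan F ≤ K := by
  refine Submodule.span_le.2 ?_
  rintro _ ⟨e, he, rfl⟩
  induction e using Sym2.ind with
  | _ u v =>
    rcases edgeVec_mk u v with h2 | h2
    · rw [h2]; exact h u v he
    · rw [h2]; exact h v u (by rw [Sym2.eq_swap]; exact he)

theorem edgeSpan_mono {F H : Finset (Sym2 V)} (h : F ⊆ H) : edgeSpan F ≤ edgeSpan H :=
  Submodule.span_mono (Set.image_mono (by exact_mod_cast h))

theorem edgeRank_mono {F H : Finset (Sym2 V)} (h : F ⊆ H) : edgeRank F ≤ edgeRank H :=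
  Submodule.finrank_mono (edgeSpan_mono h)

theorem edgeSpan_union (F H : Finset (Sym2 V)) :
    edgeSpan (F ∪ H) = edgeSpan F ⊔ edgeSpan H := by
  unfold edgeSpan
  rw [Finset.coe_union, Set.image_union, Submodule.span_union]

theorem edgeRank_union_add_finrank_inf (F H : Finset (Sym2 V)) :
    edgeRank (F ∪ H) + Module.finrank ℝ (edgeSpan F ⊓ edgeSpan H : Submodule ℝ (V → ℝ)) =
      edgeRank F + edgeRank H := by
  unfold edgeRank
  rw [edgeSpan_union]
  exact Submodule.finrank_sup_add_finrank_inf_eq _ _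

theorem edgeRank_union_add_inter_le (F H : Finset (Sym2 V)) :
    edgeRank (F ∪ H) + edgeRank (F ∩ H) ≤ edgeRank F + edgeRank H := by
  have h := edgeRank_union_add_finrank_inf F H
  have : edgeSpan (F ∩ H) ≤ edgeSpan F ⊓ edgeSpan H :=
    le_inf (edgeSpan_mono Finset.inter_subset_left) (edgeSpan_mono Finset.inter_subset_right)
  have := Submodule.finrank_mono this
  unfold edgeRank at h ⊢
  omega

theorem single_sub_single_mem_zeroSumOn {p : Finset V} {u v : V} (hu : u ∈ p) (hv : v ∈ p) :
    (Pi.single u 1 - Pi.single v 1 : V → ℝ) ∈ zeroSumOn p := by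
  refine ⟨fun w hw => ?_, by simp⟩
  have h1 : w ≠ u := by rintro rfl; exact hw hu
  have h2 : w ≠ v := by rintro rfl; exact hw hv
  simp [h1, h2]

theorem eq_sum_of_mem_zeroSumOn {p : Finset V} (v₀ : V) {w : V → ℝ}
    (hw : w ∈ zeroSumOn p) :
    w = ∑ v ∈ p.erase v₀, w v • (Pi.single v 1 - Pi.single v₀ 1 : V → ℝ) := by
  obtain ⟨h1, h2⟩ := hw
  have h3 : w = ∑ v, w v • (Pi.single v 1 - Pi.single v₀ 1 : V → ℝ) := by
    simp only [smul_sub, Finset.sum_sub_distrib, ← Finset.sum_smul, h2, zero_smul, sub_zero]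
    ext u
    simp [Finset.sum_apply, Pi.single_apply]
  conv_lhs => rw [h3]
  symm
  refine Finset.sum_subset (Finset.subset_univ _) fun v _ hv => ?_
  by_cases h : v = v₀
  · simp [h]
  · rw [h1 v (fun hp => hv (Finset.mem_erase.2 ⟨h, hp⟩)), zero_smul]

theorem zeroSumOn_le {p : Finset V} {K : Submodule ℝ (V → ℝ)}
    (h : ∀ u ∈ p, ∀ v ∈ p, (Pi.single u 1 - Pi.single v 1 : V → ℝ) ∈ K) :
    zeroSumOn p ≤ K := by
  intro w hw
  rcases p.eq_empty_or_nonempty with rfl | ⟨v₀, h₀⟩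
  · have : w = 0 := by ext v; exact hw.1 v (by simp)
    rw [this]; exact zero_mem _
  · rw [eq_sum_of_mem_zeroSumOn v₀ hw]
    exact sum_mem fun v hv => K.smul_mem _ (h v (Finset.mem_of_mem_erase hv) v₀ h₀)

theorem finrank_zeroSumOn_add_one_le {p : Finset V} (hp : p.Nonempty) :
    Module.finrank ℝ (zeroSumOn p) + 1 ≤ p.card := by
  obtain ⟨v₀, h₀⟩ := hp
  have h1 : zeroSumOn p ≤ Submodule.span ℝ
      (((p.erase v₀).image fun v => (Pi.single v 1 - Pi.single v₀ 1 : V → ℝ) :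
        Finset (V → ℝ)) : Set (V → ℝ)) := by
    intro w hw
    rw [eq_sum_of_mem_zeroSumOn v₀ hw]
    exact sum_mem fun v hv => Submodule.smul_mem _ _
      (Submodule.subset_span (by exact_mod_cast Finset.mem_image_of_mem _ hv))
  have h2 := Submodule.finrank_mono h1
  have h3 := finrank_span_finset_le_card (R := ℝ)
    ((p.erase v₀).image fun v => (Pi.single v 1 - Pi.single v₀ 1 : V → ℝ))
  have h4 : ((p.erase v₀).image fun v => (Pi.single v 1 - Pi.single v₀ 1 : V → ℝ)).card ≤
      (p.erase v₀).card := Finset.card_image_le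
  rw [Finset.card_erase_of_mem h₀] at h4
  have : 0 < p.card := Finset.card_pos.2 ⟨_, h₀⟩
  simp only [Set.finrank] at h3
  omega

theorem finrank_le_finrank_inf_ker_add_one (K : Submodule ℝ (V → ℝ)) (f : (V → ℝ) →ₗ[ℝ] ℝ) :
    Module.finrank ℝ K ≤
      Module.finrank ℝ (K ⊓ LinearMap.ker f : Submodule ℝ (V → ℝ)) + 1 := by
  have h1 := LinearMap.finrank_range_add_finrank_ker (f.domRestrict K)
  have h2 : Module.finrank ℝ (LinearMap.range (f.domRestrict K)) ≤ 1 := by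
    simpa using Submodule.finrank_le (LinearMap.range (f.domRestrict K))
  have h3 : Module.finrank ℝ (LinearMap.ker (f.domRestrict K)) =
      Module.finrank ℝ (K ⊓ LinearMap.ker f : Submodule ℝ (V → ℝ)) := by
    rw [← Submodule.map_comap_subtype, Submodule.finrank_map_subtype_eq]
    rfl
  omega

theorem card_le_finrank_zeroSumOn_univ_add_one :
    Fintype.card V ≤ Module.finrank ℝ (zeroSumOn (Finset.univ : Finset V)) + 1 := by
  have h := finrank_le_finrank_inf_ker_add_one (V := V) ⊤
    (∑ v, LinearMap.proj (R := ℝ) (φ := fun _ : V => ℝ) v)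
  have h2 : (⊤ ⊓ LinearMap.ker (∑ v, LinearMap.proj (R := ℝ) (φ := fun _ : V => ℝ) v) :
      Submodule ℝ (V → ℝ)) = zeroSumOn (Finset.univ : Finset V) := by
    ext w
    simp [zeroSumOn]
  rw [h2] at h
  simpa using h

theorem edgeSpan_le_zeroSumOn_univ (F : Finset (Sym2 V)) :
    edgeSpan F ≤ zeroSumOn Finset.univ :=
  edgeSpan_le fun _ _ _ => single_sub_single_mem_zeroSumOn (Finset.mem_univ _) (Finset.mem_univ _)

theorem edgeRank_add_one_le [Nonempty V] (F : Finset (Sym2 V)) :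
    edgeRank F + 1 ≤ Fintype.card V := by
  have h1 := Submodule.finrank_mono (edgeSpan_le_zeroSumOn_univ F)
  have h2 := finrank_zeroSumOn_add_one_le (Finset.univ_nonempty (α := V))
  unfold edgeRank
  rw [Finset.card_univ] at h2
  omega

/-! ### Level functions -/

/-- The smaller level of the endpoints of an edge. -/
def lowLevel (lev : V → ℕ) : Sym2 V → ℕ :=
  Sym2.lift ⟨fun u v => min (lev u) (lev v), fun _ _ => min_comm _ _⟩

/-- The larger level of the endpoints of an edge. -/
def highLevel (lev : V → ℕ) : Sym2 V → ℕ :=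
  Sym2.lift ⟨fun u v => max (lev u) (lev v), fun _ _ => max_comm _ _⟩

@[simp] theorem lowLevel_mk (lev : V → ℕ) (u v : V) :
    lowLevel lev s(u, v) = min (lev u) (lev v) := rfl

@[simp] theorem highLevel_mk (lev : V → ℕ) (u v : V) :
    highLevel lev s(u, v) = max (lev u) (lev v) := rfl

theorem lowLevel_le_highLevel (lev : V → ℕ) (e : Sym2 V) : lowLevel lev e ≤ highLevel lev e := by
  induction e using Sym2.ind with
  | _ u v => simp

/-- Vertices of level in `[a, c)`. -/
noncomputable def levelsIn (lev : V → ℕ) (a c : ℕ) : Finset V :=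
  Finset.univ.filter fun v => a ≤ lev v ∧ lev v < c

/-- Pairs with both endpoints of level in `[a, c)`. -/
noncomputable def pairsIn (lev : V → ℕ) (a c : ℕ) : Finset (Sym2 V) :=
  Finset.univ.filter fun e => a ≤ lowLevel lev e ∧ highLevel lev e < c

theorem mem_levelsIn {lev : V → ℕ} {a c : ℕ} {v : V} :
    v ∈ levelsIn lev a c ↔ a ≤ lev v ∧ lev v < c := by simp [levelsIn]

theorem mem_pairsIn {lev : V → ℕ} {a c : ℕ} {e : Sym2 V} :
    e ∈ pairsIn lev a c ↔ a ≤ lowLevel lev e ∧ highLevel lev e < c := by simp [pairsIn]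

/-- Whether `F` contains an edge between the levels `b - 1` and `b`. -/
noncomputable def gapHit (lev : V → ℕ) (F : Finset (Sym2 V)) (b : ℕ) : ℕ :=
  if ∃ e ∈ F, lowLevel lev e + 1 = b ∧ highLevel lev e = b then 1 else 0

/-- The rank of `F` in the direct sum of the cycle matroids of the levels and the rank-one
uniform matroids on the edges between consecutive levels. -/
noncomputable def layerRank (lev : V → ℕ) (N : ℕ) (F : Finset (Sym2 V)) : ℕ :=
  ∑ b ∈ Finset.range N, (edgeRank (F ∩ pairsIn lev b (b + 1)) + gapHit lev F b)

/-- The sum of the entries of level `b`. -/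
noncomputable def levelSum (lev : V → ℕ) (b : ℕ) : (V → ℝ) →ₗ[ℝ] ℝ :=
  ∑ v ∈ Finset.univ.filter (fun v => lev v = b), LinearMap.proj (R := ℝ) (φ := fun _ : V => ℝ) v

theorem levelSum_single (lev : V → ℕ) (b : ℕ) (u : V) :
    levelSum lev b (Pi.single u 1 : V → ℝ) = if lev u = b then 1 else 0 := by
  simp only [levelSum, LinearMap.sum_apply, LinearMap.proj_apply]
  rw [Finset.sum_filter]
  rw [Finset.sum_eq_single u]
  · simp
  · intro v _ hv; simp [hv]
  · simp

theorem levelSum_eq_zero {lev : V → ℕ} {F : Finset (Sym2 V)} {b : ℕ}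
    (h : ∀ u v, s(u, v) ∈ F → (lev u = b ↔ lev v = b)) :
    edgeSpan F ≤ LinearMap.ker (levelSum lev b) := by
  refine edgeSpan_le fun u v huv => ?_
  rw [LinearMap.mem_ker, map_sub, levelSum_single, levelSum_single]
  simp [h u v huv]

theorem pairsIn_mono {lev : V → ℕ} {a c a' c' : ℕ} (ha : a' ≤ a) (hc : c ≤ c') :
    pairsIn lev a c ⊆ pairsIn lev a' c' := by
  intro e he
  rw [mem_pairsIn] at he ⊢
  omega

theorem edgeSpan_pairsIn (lev : V → ℕ) (a c : ℕ) :
    edgeSpan (pairsIn lev a c) = zeroSumOn (levelsIn lev a c) := by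
  apply le_antisymm
  · refine edgeSpan_le fun u v huv => ?_
    rw [mem_pairsIn, lowLevel_mk, highLevel_mk] at huv
    exact single_sub_single_mem_zeroSumOn (mem_levelsIn.2 (by omega)) (mem_levelsIn.2 (by omega))
  · refine zeroSumOn_le fun u hu v hv => ?_
    rw [mem_levelsIn] at hu hv
    refine single_sub_single_mem_edgeSpan (mem_pairsIn.2 ?_)
    rw [lowLevel_mk, highLevel_mk]
    omega

theorem edgeSpan_inter_pairsIn_le (lev : V → ℕ) (F : Finset (Sym2 V)) (a c : ℕ) :
    edgeSpan (F ∩ pairsIn lev a c) ≤ zeroSumOn (levelsIn lev a c) := by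
  rw [← edgeSpan_pairsIn]
  exact edgeSpan_mono Finset.inter_subset_right

theorem edgeRank_sup_disjoint {lev : V → ℕ} (F : Finset (Sym2 V)) (a b : ℕ) :
    Module.finrank ℝ (edgeSpan (F ∩ pairsIn lev a b) ⊔ edgeSpan (F ∩ pairsIn lev b (b + 1)) :
      Submodule ℝ (V → ℝ)) =
      edgeRank (F ∩ pairsIn lev a b) + edgeRank (F ∩ pairsIn lev b (b + 1)) := by
  have h := Submodule.finrank_sup_add_finrank_inf_eq
    (edgeSpan (F ∩ pairsIn lev a b)) (edgeSpan (F ∩ pairsIn lev b (b + 1)))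
  have h0 : (edgeSpan (F ∩ pairsIn lev a b) ⊓ edgeSpan (F ∩ pairsIn lev b (b + 1)) :
      Submodule ℝ (V → ℝ)) = ⊥ := by
    rw [eq_bot_iff]
    rintro w ⟨h1, h2⟩
    have h1 := edgeSpan_inter_pairsIn_le _ _ _ _ h1
    have h2 := edgeSpan_inter_pairsIn_le _ _ _ _ h2
    rw [Submodule.mem_bot]
    ext v
    by_cases hv : lev v < b
    · exact h2.1 v (fun hm => by rw [mem_levelsIn] at hm; omega)
    · exact h1.1 v (fun hm => by rw [mem_levelsIn] at hm; omega)
  rw [h0, finrank_bot] at h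
  unfold edgeRank
  omega

theorem edgeSpan_sup_le_inf_ker {lev : V → ℕ} (F : Finset (Sym2 V)) (a b : ℕ) (hab : a ≤ b) :
    edgeSpan (F ∩ pairsIn lev a b) ⊔ edgeSpan (F ∩ pairsIn lev b (b + 1)) ≤
      edgeSpan (F ∩ pairsIn lev a (b + 1)) ⊓ LinearMap.ker (levelSum lev b) := by
  refine sup_le (le_inf (edgeSpan_mono ?_) (levelSum_eq_zero ?_))
    (le_inf (edgeSpan_mono ?_) (levelSum_eq_zero ?_))
  · exact Finset.inter_subset_inter_left (pairsIn_mono le_rfl (by omega))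
  · intro u v h
    rw [Finset.mem_inter, mem_pairsIn, lowLevel_mk, highLevel_mk] at h
    omega
  · exact Finset.inter_subset_inter_left (pairsIn_mono hab le_rfl)
  · intro u v h
    rw [Finset.mem_inter, mem_pairsIn, lowLevel_mk, highLevel_mk] at h
    omega

theorem edgeRank_add_le {lev : V → ℕ} (F : Finset (Sym2 V)) (a b : ℕ) (hab : a ≤ b) :
    edgeRank (F ∩ pairsIn lev a b) + edgeRank (F ∩ pairsIn lev b (b + 1)) ≤
      edgeRank (F ∩ pairsIn lev a (b + 1)) := by
  rw [← edgeRank_sup_disjoint]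
  exact Submodule.finrank_mono ((edgeSpan_sup_le_inf_ker F a b hab).trans inf_le_left)

theorem edgeRank_add_lt {lev : V → ℕ} {F : Finset (Sym2 V)} {a b : ℕ} (hab : a ≤ b)
    {w : V → ℝ} (hw : w ∈ edgeSpan (F ∩ pairsIn lev a (b + 1))) (hw0 : levelSum lev b w ≠ 0) :
    edgeRank (F ∩ pairsIn lev a b) + edgeRank (F ∩ pairsIn lev b (b + 1)) <
      edgeRank (F ∩ pairsIn lev a (b + 1)) := by
  rw [← edgeRank_sup_disjoint]
  refine lt_of_le_of_lt (Submodule.finrank_mono (edgeSpan_sup_le_inf_ker F a b hab)) ?_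
  refine Submodule.finrank_lt_finrank_of_lt (lt_of_le_of_ne inf_le_left fun h => hw0 ?_)
  rw [← h] at hw
  exact hw.2

theorem levelSum_edge {lev : V → ℕ} {b : ℕ} {u v : V} (hu : lev u ≠ b) (hv : lev v = b) :
    levelSum lev b (Pi.single u 1 - Pi.single v 1 : V → ℝ) = -1 := by
  rw [map_sub, levelSum_single, levelSum_single, if_neg hu, if_pos hv]
  norm_num

theorem gapHit_le_one (lev : V → ℕ) (F : Finset (Sym2 V)) (b : ℕ) : gapHit lev F b ≤ 1 := by
  unfold gapHit; split_ifs <;> simp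

theorem exists_of_gapHit {lev : V → ℕ} {F : Finset (Sym2 V)} {b : ℕ} (h : gapHit lev F b ≠ 0) :
    ∃ u v, s(u, v) ∈ F ∧ lev u + 1 = b ∧ lev v = b := by
  unfold gapHit at h
  split_ifs at h with h1
  · obtain ⟨e, he, h1, h2⟩ := h1
    induction e using Sym2.ind with
    | _ u v =>
      rw [lowLevel_mk] at h1
      rw [highLevel_mk] at h2
      rcases le_total (lev u) (lev v) with h | h
      · exact ⟨u, v, he, by omega, by omega⟩
      · exact ⟨v, u, by rwa [Sym2.eq_swap], by omega, by omega⟩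
  · exact absurd rfl h

theorem gapHit_pos {lev : V → ℕ} {F : Finset (Sym2 V)} {b : ℕ} {e : Sym2 V} (he : e ∈ F)
    (h1 : lowLevel lev e + 1 = b) (h2 : highLevel lev e = b) : gapHit lev F b = 1 := by
  unfold gapHit
  rw [if_pos ⟨e, he, h1, h2⟩]

theorem edgeRank_add_gapHit_le {lev : V → ℕ} (F : Finset (Sym2 V)) (b : ℕ) :
    edgeRank (F ∩ pairsIn lev 0 b) + edgeRank (F ∩ pairsIn lev b (b + 1)) + gapHit lev F b ≤
      edgeRank (F ∩ pairsIn lev 0 (b + 1)) := by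
  by_cases h : gapHit lev F b = 0
  · rw [h]; exact edgeRank_add_le F 0 b (Nat.zero_le _)
  · obtain ⟨u, v, he, h1, h2⟩ := exists_of_gapHit h
    have := edgeRank_add_lt (lev := lev) (F := F) (a := 0) (b := b) (Nat.zero_le _)
      (single_sub_single_mem_edgeSpan (u := u) (v := v)
        (Finset.mem_inter.2 ⟨he, mem_pairsIn.2 (by rw [lowLevel_mk, highLevel_mk]; omega)⟩))
      (by rw [levelSum_edge (by omega) h2]; norm_num)
    have := gapHit_le_one lev F b
    omega

theorem sum_layer_le (lev : V → ℕ) (F : Finset (Sym2 V)) (c : ℕ) :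
    layerRank lev c F ≤ edgeRank (F ∩ pairsIn lev 0 c) := by
  induction c with
  | zero => simp [layerRank]
  | succ c ih =>
    unfold layerRank at ih ⊢
    rw [Finset.sum_range_succ]
    have := edgeRank_add_gapHit_le (lev := lev) F c
    omega

theorem inter_pairsIn_eq {lev : V → ℕ} {N : ℕ} (hN : ∀ v, lev v < N) (F : Finset (Sym2 V)) :
    F ∩ pairsIn lev 0 N = F := by
  refine Finset.inter_eq_left.2 fun e _ => mem_pairsIn.2 ⟨Nat.zero_le _, ?_⟩
  induction e using Sym2.ind with
  | _ u v =>
    rw [highLevel_mk]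
    have := hN u
    have := hN v
    omega

theorem layerRank_le_edgeRank {lev : V → ℕ} {N : ℕ} (hN : ∀ v, lev v < N) (F : Finset (Sym2 V)) :
    layerRank lev N F ≤ edgeRank F := by
  have := sum_layer_le lev F N
  rwa [inter_pairsIn_eq hN] at this

theorem gapHit_submodular (lev : V → ℕ) (F H : Finset (Sym2 V)) (b : ℕ) :
    gapHit lev (F ∪ H) b + gapHit lev (F ∩ H) b ≤ gapHit lev F b + gapHit lev H b := by
  have h1 : ∀ {A B : Finset (Sym2 V)}, A ⊆ B → gapHit lev A b ≤ gapHit lev B b := by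
    intro A B hAB
    by_cases h : ∃ e ∈ A, lowLevel lev e + 1 = b ∧ highLevel lev e = b
    · obtain ⟨e, he, h1, h2⟩ := h
      rw [gapHit_pos (hAB he) h1 h2]
      exact gapHit_le_one _ _ _
    · simp [gapHit, h]
  have h2 := h1 (Finset.inter_subset_left (s₁ := F) (s₂ := H))
  have h3 := h1 (Finset.inter_subset_right (s₁ := F) (s₂ := H))
  have h4 : gapHit lev (F ∪ H) b ≤ max (gapHit lev F b) (gapHit lev H b) := by
    by_cases h : ∃ e ∈ F ∪ H, lowLevel lev e + 1 = b ∧ highLevel lev e = b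
    · obtain ⟨e, he, h1, h2⟩ := h
      have := gapHit_le_one lev (F ∪ H) b
      rcases Finset.mem_union.1 he with he | he
      · rw [gapHit_pos he h1 h2]; omega
      · rw [gapHit_pos he h1 h2]; omega
    · have : gapHit lev (F ∪ H) b = 0 := if_neg h
      omega
  omega

theorem layerRank_submodular (lev : V → ℕ) (N : ℕ) (F H : Finset (Sym2 V)) :
    layerRank lev N (F ∪ H) + layerRank lev N (F ∩ H) ≤ layerRank lev N F + layerRank lev N H := by
  unfold layerRank
  rw [← Finset.sum_add_distrib, ← Finset.sum_add_distrib]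
  refine Finset.sum_le_sum fun b _ => ?_
  have h1 := gapHit_submodular lev F H b
  have h2 := edgeRank_union_add_inter_le (F ∩ pairsIn lev b (b + 1)) (H ∩ pairsIn lev b (b + 1))
  rw [← Finset.union_inter_distrib_right, ← Finset.inter_inter_distrib_right] at h2
  omega

/-! ### The rank inequality -/

/-- The properties of a point of the spanning tree polytope with respect to a level function
that are needed to split off a `lam`-fraction of Gao-trees. -/
structure LayeredPoint (lev : V → ℕ) (N : ℕ) (lam : ℝ) (x : Sym2 V → ℝ) : Prop where
  lev_lt : ∀ v, lev v < N
  exists_lev : ∀ b < N, ∃ v, lev v = b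
  nonneg : ∀ e, 0 ≤ x e
  lam_pos : 0 < lam
  lam_le_one : lam ≤ 1
  sum_le_edgeRank : ∀ F : Finset (Sym2 V), ∑ e ∈ F, x e ≤ edgeRank F
  le_sum_pairsIn : ∀ a c, a < c → c ≤ N →
    ((levelsIn lev a c).card : ℝ) - 2 + lam ≤ ∑ e ∈ pairsIn lev a c, x e
  sum_cut_le : ∀ b, 0 < b → b < N →
    ∑ e ∈ Finset.univ.filter (fun e => lowLevel lev e < b ∧ b ≤ highLevel lev e), x e ≤ 2 - lam
  sum_jump_le : ∀ b,
    ∑ e ∈ Finset.univ.filter (fun e => lowLevel lev e < b ∧ b < highLevel lev e), x e ≤ 1 - lam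

/-- The slack of `F` in the rank inequality. -/
noncomputable def slack (lev : V → ℕ) (N : ℕ) (lam : ℝ) (x : Sym2 V → ℝ)
    (F : Finset (Sym2 V)) : ℝ :=
  (1 - lam) * edgeRank F + lam * layerRank lev N F - ∑ e ∈ F, x e

/-- `F` is closed if its restrictions to level intervals have no connections outside. -/
def LevelClosed (lev : V → ℕ) (F : Finset (Sym2 V)) : Prop :=
  ∀ a c, edgeSpan F ⊓ zeroSumOn (levelsIn lev a c) ≤ edgeSpan (F ∩ pairsIn lev a c)

theorem slack_union_neg {lev : V → ℕ} {N : ℕ} {lam : ℝ} {x : Sym2 V → ℝ}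
    (hx : LayeredPoint lev N lam x) {F : Finset (Sym2 V)} (hF : slack lev N lam x F < 0)
    {a c : ℕ} (hac : a < c) (hc : c ≤ N) (hFH : 0 ≤ slack lev N lam x (F ∩ pairsIn lev a c))
    (hn : ¬ edgeSpan F ⊓ zeroSumOn (levelsIn lev a c) ≤ edgeSpan (F ∩ pairsIn lev a c)) :
    slack lev N lam x (F ∪ pairsIn lev a c) < 0 ∧ F ⊂ F ∪ pairsIn lev a c := by
  have hsub : edgeSpan (F ∩ pairsIn lev a c) ≤ edgeSpan F ⊓ edgeSpan (pairsIn lev a c) :=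
    le_inf (edgeSpan_mono Finset.inter_subset_left) (edgeSpan_mono Finset.inter_subset_right)
  rw [← edgeSpan_pairsIn] at hn
  have h1 := Submodule.finrank_lt_finrank_of_lt (lt_of_le_not_ge hsub hn)
  have h2 := edgeRank_union_add_finrank_inf F (pairsIn lev a c)
  have h3 := layerRank_submodular lev N F (pairsIn lev a c)
  have h4 := layerRank_le_edgeRank hx.lev_lt (pairsIn lev a c)
  have hne : (levelsIn lev a c).Nonempty := by
    obtain ⟨v, hv⟩ := hx.exists_lev a (by omega)
    exact ⟨v, mem_levelsIn.2 (by omega)⟩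
  have h5 := finrank_zeroSumOn_add_one_le hne
  rw [← edgeSpan_pairsIn] at h5
  have h6 := hx.le_sum_pairsIn a c hac hc
  have h7 := Finset.sum_union_inter (s₁ := F) (s₂ := pairsIn lev a c) (f := x)
  have hl := hx.lam_pos
  have hl1 := hx.lam_le_one
  constructor
  · unfold slack at hF hFH ⊢
    have g1 : (edgeRank (F ∪ pairsIn lev a c) : ℝ) + edgeRank (F ∩ pairsIn lev a c) + 1 ≤
        edgeRank F + edgeRank (pairsIn lev a c) := by
      have : edgeRank (F ∪ pairsIn lev a c) + edgeRank (F ∩ pairsIn lev a c) + 1 ≤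
        edgeRank F + edgeRank (pairsIn lev a c) := by
        unfold edgeRank at h2 ⊢
        omega
      exact_mod_cast this
    have g2 : (layerRank lev N (F ∪ pairsIn lev a c) : ℝ) + layerRank lev N (F ∩ pairsIn lev a c) ≤
        layerRank lev N F + layerRank lev N (pairsIn lev a c) := by exact_mod_cast h3
    have g3 : (layerRank lev N (pairsIn lev a c) : ℝ) ≤ edgeRank (pairsIn lev a c) := by
      exact_mod_cast h4
    have g4 : (edgeRank (pairsIn lev a c) : ℝ) + 1 ≤ (levelsIn lev a c).card := by
      unfold edgeRank
      exact_mod_cast h5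
    have k1 := mul_le_mul_of_nonneg_left g1 (sub_nonneg.2 hl1)
    have k2 := mul_le_mul_of_nonneg_left g2 hl.le
    have k3 := mul_le_mul_of_nonneg_left g3 hl.le
    nlinarith
  · refine Finset.ssubset_iff_subset_ne.2 ⟨Finset.subset_union_left, fun h => hn ?_⟩
    have : pairsIn lev a c ⊆ F := by rw [h]; exact Finset.subset_union_right
    rw [Finset.inter_eq_right.2 this]
    exact inf_le_right

/-- Level `b` is attached to the lower levels by `F` in a single component, using an edge
from level `b - 1`. -/
def TightLevel (lev : V → ℕ) (F : Finset (Sym2 V)) (b : ℕ) : Prop :=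
  gapHit lev F b = 1 ∧ edgeRank (F ∩ pairsIn lev 0 (b + 1)) ≤
    edgeRank (F ∩ pairsIn lev 0 b) + edgeRank (F ∩ pairsIn lev b (b + 1)) + 1

theorem TightLevel.inf_ker_le {lev : V → ℕ} {F : Finset (Sym2 V)} {b : ℕ}
    (h : TightLevel lev F b) :
    edgeSpan (F ∩ pairsIn lev 0 (b + 1)) ⊓ LinearMap.ker (levelSum lev b) ≤
      edgeSpan (F ∩ pairsIn lev 0 b) ⊔ edgeSpan (F ∩ pairsIn lev b (b + 1)) := by
  obtain ⟨u, v, he, h1, h2⟩ := exists_of_gapHit (by rw [h.1]; exact one_ne_zero)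
  have hm : (Pi.single u 1 - Pi.single v 1 : V → ℝ) ∈ edgeSpan (F ∩ pairsIn lev 0 (b + 1)) :=
    single_sub_single_mem_edgeSpan
      (Finset.mem_inter.2 ⟨he, mem_pairsIn.2 (by rw [lowLevel_mk, highLevel_mk]; omega)⟩)
  have hlt : edgeSpan (F ∩ pairsIn lev 0 (b + 1)) ⊓ LinearMap.ker (levelSum lev b) <
      edgeSpan (F ∩ pairsIn lev 0 (b + 1)) := by
    refine lt_of_le_of_ne inf_le_left fun hh => ?_
    rw [← hh] at hm
    have := hm.2
    rw [SetLike.mem_coe, LinearMap.mem_ker, levelSum_edge (by omega) h2] at this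
    norm_num at this
  have hlt := Submodule.finrank_lt_finrank_of_lt hlt
  have h3 := h.2
  have h4 := edgeRank_sup_disjoint (lev := lev) F 0 b
  refine (Submodule.eq_of_le_of_finrank_le (edgeSpan_sup_le_inf_ker F 0 b (Nat.zero_le _)) ?_).ge
  rw [h4]
  unfold edgeRank at h3 ⊢
  omega

theorem TightLevel.edgeRank_le {lev : V → ℕ} {F : Finset (Sym2 V)} (hF : LevelClosed lev F)
    {a b : ℕ} (h : TightLevel lev F b) :
    edgeRank (F ∩ pairsIn lev a (b + 1)) ≤
      edgeRank (F ∩ pairsIn lev a b) + edgeRank (F ∩ pairsIn lev b (b + 1)) + 1 := by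
  rw [← edgeRank_sup_disjoint]
  refine (finrank_le_finrank_inf_ker_add_one _ (levelSum lev b)).trans
    (Nat.add_le_add_right (Submodule.finrank_mono ?_) 1)
  rintro w ⟨hw1, hw2⟩
  have hw0 : w ∈ edgeSpan (F ∩ pairsIn lev 0 (b + 1)) :=
    edgeSpan_mono (Finset.inter_subset_inter_left (pairsIn_mono (Nat.zero_le _) le_rfl)) hw1
  obtain ⟨w1, h1, w2, h2, h12⟩ := Submodule.mem_sup.1 (h.inf_ker_le ⟨hw0, hw2⟩)
  refine Submodule.mem_sup.2 ⟨w1, hF a b ⟨?_, ?_, ?_⟩, w2, h2, h12⟩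
  · exact edgeSpan_mono Finset.inter_subset_left h1
  · intro v hv
    have z1 := edgeSpan_inter_pairsIn_le _ _ _ _ h1
    have z2 := edgeSpan_inter_pairsIn_le _ _ _ _ h2
    have z := edgeSpan_inter_pairsIn_le _ _ _ _ hw1
    rw [mem_levelsIn] at hv
    by_cases hvb : lev v < b
    · have e1 := z.1 v (fun hm => by rw [mem_levelsIn] at hm; omega)
      have e2 := z2.1 v (fun hm => by rw [mem_levelsIn] at hm; omega)
      rw [← h12, Pi.add_apply, e2, add_zero] at e1
      exact e1
    · exact z1.1 v (fun hm => by rw [mem_levelsIn] at hm; omega)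
  · exact (edgeSpan_inter_pairsIn_le _ _ _ _ h1).2

theorem edgeRank_block_le {lev : V → ℕ} {F : Finset (Sym2 V)} (hF : LevelClosed lev F)
    {a c : ℕ} (hac : a < c) (h : ∀ b, a < b → b < c → TightLevel lev F b) :
    edgeRank (F ∩ pairsIn lev a c) + a + 1 ≤
      ∑ b ∈ Finset.Ico a c, edgeRank (F ∩ pairsIn lev b (b + 1)) + c := by
  induction c, hac using Nat.le_induction with
  | base => simp
  | succ c hc ih =>
    have h1 := (h c (by omega) (by omega)).edgeRank_le hF (a := a)
    have h2 := ih fun b hb hb' => h b hb (by omega)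
    rw [Finset.sum_Ico_succ_top (by omega)]
    omega

theorem exists_connected_level {lev : V → ℕ} {F : Finset (Sym2 V)} (hF : LevelClosed lev F)
    {a d : ℕ} (had : a ≤ d) (h : ∀ b, a < b → b ≤ d → TightLevel lev F b) {u : V}
    (hu : lev u < a) {v : V} (hv : lev v = d)
    (huv : (Pi.single u 1 - Pi.single v 1 : V → ℝ) ∈ edgeSpan F) :
    ∃ w, lev w = a ∧ (Pi.single u 1 - Pi.single w 1 : V → ℝ) ∈ edgeSpan F := by
  induction d, had using Nat.le_induction generalizing v with
  | base => exact ⟨v, hv, huv⟩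
  | succ d hd ih =>
    have hT := h (d + 1) (by omega) le_rfl
    obtain ⟨s, t, he, h1, h2⟩ := exists_of_gapHit (by rw [hT.1]; exact one_ne_zero)
    refine ih (fun b hb hb' => h b hb (by omega)) (v := s) (by omega) ?_
    have hst := single_sub_single_mem_edgeSpan he
    have hg : (Pi.single u 1 - Pi.single v 1 - (Pi.single s 1 - Pi.single t 1) : V → ℝ) ∈
        edgeSpan (F ∩ pairsIn lev 0 (d + 1 + 1)) := by
      refine hF 0 (d + 1 + 1) ⟨sub_mem huv hst, sub_mem ?_ ?_⟩ <;>
      exact single_sub_single_mem_zeroSumOn (mem_levelsIn.2 (by omega)) (mem_levelsIn.2 (by omega))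
    have hk : (Pi.single u 1 - Pi.single v 1 - (Pi.single s 1 - Pi.single t 1) : V → ℝ) ∈
        LinearMap.ker (levelSum lev (d + 1)) := by
      rw [LinearMap.mem_ker, map_sub, levelSum_edge (by omega) hv, levelSum_edge (by omega) h2]
      norm_num
    obtain ⟨w1, hw1, w2, hw2, h12⟩ := Submodule.mem_sup.1 (hT.inf_ker_le ⟨hg, hk⟩)
    have z1 := edgeSpan_inter_pairsIn_le _ _ _ _ hw1
    have z2 := edgeSpan_inter_pairsIn_le _ _ _ _ hw2
    have : (Pi.single u 1 - Pi.single s 1 : V → ℝ) = w1 := by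
      ext y
      by_cases hy : lev y < d + 1
      · have e2 := z2.1 y (fun hm => by rw [mem_levelsIn] at hm; omega)
        have e := congrFun h12 y
        have hyv : y ≠ v := by rintro rfl; omega
        have hyt : y ≠ t := by rintro rfl; omega
        simp only [Pi.add_apply, Pi.sub_apply, e2, add_zero, Pi.single_eq_of_ne hyv,
          Pi.single_eq_of_ne hyt, sub_zero] at e
        rw [e, Pi.sub_apply]
      · have e1 := z1.1 y (fun hm => by rw [mem_levelsIn] at hm; omega)
        have hyu : y ≠ u := by rintro rfl; omega
        have hys : y ≠ s := by rintro rfl; omega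
        rw [e1, Pi.sub_apply, Pi.single_eq_of_ne hyu, Pi.single_eq_of_ne hys, sub_zero]
    rw [this]
    exact edgeSpan_mono Finset.inter_subset_left hw1

theorem exists_endpoints (lev : V → ℕ) (e : Sym2 V) :
    ∃ u v, e = s(u, v) ∧ lev u = lowLevel lev e ∧ lev v = highLevel lev e := by
  induction e using Sym2.ind with
  | _ u v =>
    rcases le_total (lev u) (lev v) with h | h
    · exact ⟨u, v, rfl, by simp [h], by simp [h]⟩
    · exact ⟨v, u, Sym2.eq_swap, by simp [h], by simp [h]⟩

theorem sum_incoming_le {lev : V → ℕ} {N : ℕ} {lam : ℝ} {x : Sym2 V → ℝ}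
    (hx : LayeredPoint lev N lam x) {F : Finset (Sym2 V)} (hF : LevelClosed lev F)
    {a c : ℕ} (hac : a < c) (hc : c ≤ N) (h : ∀ b, a < b → b < c → TightLevel lev F b)
    (ha : ¬ TightLevel lev F a) :
    ∑ e ∈ F.filter (fun e => lowLevel lev e < a ∧ a ≤ highLevel lev e ∧ highLevel lev e < c), x e ≤
      (1 - lam) * ((edgeRank (F ∩ pairsIn lev 0 (a + 1)) : ℝ) - edgeRank (F ∩ pairsIn lev 0 a) -
        edgeRank (F ∩ pairsIn lev a (a + 1))) + lam * gapHit lev F a := by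
  set Y := F.filter fun e => lowLevel lev e < a ∧ a ≤ highLevel lev e ∧ highLevel lev e < c with hY
  have hl := hx.lam_pos
  have hl1 := hx.lam_le_one
  have hq0 := edgeRank_add_gapHit_le (lev := lev) F a
  have hg1 := gapHit_le_one lev F a
  obtain ⟨q, hq⟩ := Nat.exists_eq_add_of_le (show edgeRank (F ∩ pairsIn lev 0 a) +
    edgeRank (F ∩ pairsIn lev a (a + 1)) ≤ edgeRank (F ∩ pairsIn lev 0 (a + 1)) by omega)
  have hqr : (edgeRank (F ∩ pairsIn lev 0 (a + 1)) : ℝ) - edgeRank (F ∩ pairsIn lev 0 a) -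
        edgeRank (F ∩ pairsIn lev a (a + 1)) = q := by
    rw [hq]; push_cast; ring
  rw [hqr]
  have hqn : (0 : ℝ) ≤ q := Nat.cast_nonneg _
  rcases Y.eq_empty_or_nonempty with hY0 | ⟨e₀, he₀⟩
  · rw [hY0, Finset.sum_empty]
    have : (0 : ℝ) ≤ gapHit lev F a := Nat.cast_nonneg _
    have := mul_nonneg (sub_nonneg.2 hl1) hqn
    positivity
  have key : ∀ e ∈ Y, ∃ u w, lev u = lowLevel lev e ∧ lev w = a ∧
      (Pi.single u 1 - Pi.single w 1 : V → ℝ) ∈ edgeSpan F := by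
    intro e he
    rw [hY, Finset.mem_filter] at he
    obtain ⟨he, h1, h2, h3⟩ := he
    obtain ⟨u, v, rfl, hu, hv⟩ := exists_endpoints lev e
    rw [← hu] at h1
    rw [← hv] at h2 h3
    obtain ⟨w, hw, huw⟩ := exists_connected_level hF h2 (fun b hb hb' => h b hb (by omega)) h1 rfl
      (single_sub_single_mem_edgeSpan he)
    exact ⟨u, w, hu, hw, huw⟩
  have h0a : lowLevel lev e₀ < a := by
    rw [hY, Finset.mem_filter] at he₀
    exact he₀.2.1
  have hq1 : 1 ≤ q := by
    obtain ⟨u, w, hu, hw, huw⟩ := key e₀ he₀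
    have := edgeRank_add_lt (lev := lev) (F := F) (a := 0) (b := a) (Nat.zero_le _)
      (hF 0 (a + 1) ⟨huw, single_sub_single_mem_zeroSumOn (mem_levelsIn.2 (by omega))
        (mem_levelsIn.2 (by omega))⟩)
      (by rw [levelSum_edge (by omega) hw]; norm_num)
    omega
  have hmono : ∀ {A : Finset (Sym2 V)}, Y ⊆ A → ∑ e ∈ Y, x e ≤ ∑ e ∈ A, x e := fun hA =>
    Finset.sum_le_sum_of_subset_of_nonneg hA fun e _ _ => hx.nonneg e
  by_cases hg : gapHit lev F a = 1
  · have hq2 : 2 ≤ q := by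
      by_contra hcon
      exact ha ⟨hg, by omega⟩
    have hq2 : (2 : ℝ) ≤ q := by exact_mod_cast hq2
    have h1 := hx.sum_cut_le a (by omega) (by omega)
    have h2 : ∑ e ∈ Y, x e ≤
        ∑ e ∈ Finset.univ.filter (fun e => lowLevel lev e < a ∧ a ≤ highLevel lev e), x e := by
      refine hmono fun e he => ?_
      rw [hY, Finset.mem_filter] at he
      exact Finset.mem_filter.2 ⟨Finset.mem_univ _, he.2.1, he.2.2.1⟩
    have := mul_le_mul_of_nonneg_left hq2 (sub_nonneg.2 hl1)
    rw [hg]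
    push_cast
    linarith
  · have hg : gapHit lev F a = 0 := by omega
    have h1 := hx.sum_jump_le (a - 1)
    have h2 : ∑ e ∈ Y, x e ≤ ∑ e ∈ Finset.univ.filter
        (fun e => lowLevel lev e < a - 1 ∧ a - 1 < highLevel lev e), x e := by
      refine hmono fun e he => ?_
      obtain ⟨u, w, hu, hw, huw⟩ := key e he
      rw [hY, Finset.mem_filter] at he
      refine Finset.mem_filter.2 ⟨Finset.mem_univ _, ?_, by omega⟩
      by_contra hcon
      have hm := hF (a - 1) (a + 1) ⟨huw, single_sub_single_mem_zeroSumOn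
        (mem_levelsIn.2 (by omega)) (mem_levelsIn.2 (by omega))⟩
      have hno : ∀ u v, s(u, v) ∈ F → lev u + 1 = a → lev v = a → False := by
        intro u v huv h1 h2
        have := gapHit_pos (lev := lev) (b := a) huv (by rw [lowLevel_mk]; omega)
          (by rw [highLevel_mk]; omega)
        omega
      have hk := levelSum_eq_zero (lev := lev) (F := F ∩ pairsIn lev (a - 1) (a + 1)) (b := a)
        (by
          intro u v huv
          rw [Finset.mem_inter, mem_pairsIn, lowLevel_mk, highLevel_mk] at huv
          have h1 := hno u v huv.1
          have h2 := hno v u (by rw [Sym2.eq_swap]; exact huv.1)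
          by_cases hua : lev u = a <;> by_cases hva : lev v = a <;> simp only [hua, hva]
          · exact (h2 (by omega) hua).elim
          · exact (h1 (by omega) hva).elim) hm
      rw [LinearMap.mem_ker, levelSum_edge (by omega) hw] at hk
      norm_num at hk
    have hq1 : (1 : ℝ) ≤ q := by exact_mod_cast hq1
    have := mul_le_mul_of_nonneg_left hq1 (sub_nonneg.2 hl1)
    rw [hg]
    push_cast
    linarith

theorem exists_block_start (P : ℕ → Prop) (h0 : ¬ P 0) (c : ℕ) :
    ∃ a ≤ c, ¬ P a ∧ ∀ b, a < b → b ≤ c → P b := by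
  induction c with
  | zero => exact ⟨0, le_rfl, h0, fun b hb hb' => by omega⟩
  | succ c ih =>
    by_cases hP : P (c + 1)
    · obtain ⟨a, ha, hna, hab⟩ := ih
      refine ⟨a, by omega, hna, fun b hb hb' => ?_⟩
      rcases Nat.lt_or_ge c b with h | h
      · rwa [show b = c + 1 by omega]
      · exact hab b hb h
    · exact ⟨c + 1, le_rfl, hP, fun b hb hb' => by omega⟩

theorem sum_inter_pairsIn_le {lev : V → ℕ} {N : ℕ} {lam : ℝ} {x : Sym2 V → ℝ}
    (hx : LayeredPoint lev N lam x) {F : Finset (Sym2 V)} (hF : LevelClosed lev F)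
    (c : ℕ) (hc : c ≤ N) :
    ∑ e ∈ F ∩ pairsIn lev 0 c, x e ≤
      (1 - lam) * edgeRank (F ∩ pairsIn lev 0 c) + lam * layerRank lev c F := by
  induction c using Nat.strong_induction_on with
  | _ c ih =>
  rcases Nat.eq_zero_or_pos c with rfl | hc0
  · have : F ∩ pairsIn lev 0 0 = ∅ := by
      ext e
      simp [mem_pairsIn]
    rw [this, Finset.sum_empty]
    have := hx.lam_pos
    have := sub_nonneg.2 hx.lam_le_one
    positivity
  obtain ⟨a, hac, hna, hT⟩ := exists_block_start (TightLevel lev F) (by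
    rintro ⟨h1, -⟩
    obtain ⟨u, v, -, h, -⟩ := exists_of_gapHit (lev := lev) (F := F) (b := 0) (by omega)
    omega) (c - 1)
  have hT : ∀ b, a < b → b < c → TightLevel lev F b := fun b hb hb' => hT b hb (by omega)
  have hac : a < c := by omega
  have h1 := ih a hac (by omega)
  have h2 := sum_incoming_le hx hF hac hc hT hna
  have h3 := hx.sum_le_edgeRank (F ∩ pairsIn lev a c)
  have h4 := edgeRank_block_le hF hac hT
  have hsum : ∑ e ∈ F ∩ pairsIn lev 0 c, x e = ∑ e ∈ F ∩ pairsIn lev 0 a, x e +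
      ∑ e ∈ F ∩ pairsIn lev a c, x e + ∑ e ∈ F.filter
        (fun e => lowLevel lev e < a ∧ a ≤ highLevel lev e ∧ highLevel lev e < c), x e := by
    rw [← Finset.sum_union, ← Finset.sum_union]
    · refine Finset.sum_congr ?_ fun _ _ => rfl
      ext e
      have := lowLevel_le_highLevel lev e
      simp only [Finset.mem_union, Finset.mem_inter, Finset.mem_filter, mem_pairsIn]
      by_cases he : e ∈ F <;> simp only [he, true_and, false_and, or_self]
      omega
    · rw [Finset.disjoint_left]
      intro e he
      simp only [Finset.mem_union, Finset.mem_inter, Finset.mem_filter, mem_pairsIn] at he ⊢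
      omega
    · rw [Finset.disjoint_left]
      intro e he
      have := lowLevel_le_highLevel lev e
      simp only [Finset.mem_inter, mem_pairsIn] at he ⊢
      omega
  -- rank increments over the block
  have hblock : ∀ d, a < d → d ≤ c →
      (∑ b ∈ Finset.Ico a d, (edgeRank (F ∩ pairsIn lev b (b + 1)) : ℝ)) + d - a - 1 +
        ((1 - lam) * ((edgeRank (F ∩ pairsIn lev 0 (a + 1)) : ℝ) -
          edgeRank (F ∩ pairsIn lev 0 a) - edgeRank (F ∩ pairsIn lev a (a + 1))) +
          lam * gapHit lev F a) ≤
      (1 - lam) * ((edgeRank (F ∩ pairsIn lev 0 d) : ℝ) - edgeRank (F ∩ pairsIn lev 0 a)) +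
        lam * ((layerRank lev d F : ℝ) - layerRank lev a F) := by
    intro d hd
    induction d, hd using Nat.le_induction with
    | base =>
      intro _
      simp only [layerRank, Finset.sum_range_succ, Nat.Ico_succ_singleton, Finset.sum_singleton]
      push_cast
      linarith
    | succ d hd ihd =>
      intro hdc
      have h := ihd (by omega)
      have hTd := (hT d hd (by omega)).1
      have hr := edgeRank_add_gapHit_le (lev := lev) F d
      rw [hTd] at hr
      have hr : (edgeRank (F ∩ pairsIn lev 0 d) : ℝ) + edgeRank (F ∩ pairsIn lev d (d + 1)) + 1 ≤
        edgeRank (F ∩ pairsIn lev 0 (d + 1)) := by exact_mod_cast hr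
      have hr := mul_le_mul_of_nonneg_left hr (sub_nonneg.2 hx.lam_le_one)
      rw [Finset.sum_Ico_succ_top (by omega)]
      have hL : (layerRank lev (d + 1) F : ℝ) = layerRank lev d F +
          (edgeRank (F ∩ pairsIn lev d (d + 1)) + 1) := by
        simp only [layerRank, Finset.sum_range_succ, hTd]
        push_cast
        ring
      rw [hL]
      push_cast
      linarith
  have h5 := hblock c hac le_rfl
  have h4 : (edgeRank (F ∩ pairsIn lev a c) : ℝ) + a + 1 ≤
      ∑ b ∈ Finset.Ico a c, (edgeRank (F ∩ pairsIn lev b (b + 1)) : ℝ) + c := by exact_mod_cast h4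
  rw [hsum]
  linarith

theorem slack_nonneg_of_levelClosed {lev : V → ℕ} {N : ℕ} {lam : ℝ} {x : Sym2 V → ℝ}
    (hx : LayeredPoint lev N lam x) {F : Finset (Sym2 V)} (hF : LevelClosed lev F) :
    0 ≤ slack lev N lam x F := by
  have := sum_inter_pairsIn_le hx hF N le_rfl
  rw [inter_pairsIn_eq hx.lev_lt] at this
  unfold slack
  linarith

theorem slack_nonneg_of_subset_pairsIn {lev : V → ℕ} {N : ℕ} {lam : ℝ} {x : Sym2 V → ℝ}
    (hx : LayeredPoint lev N lam x) (n : ℕ) :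
    ∀ A C, C - A = n → C ≤ N → ∀ F ⊆ pairsIn lev A C, 0 ≤ slack lev N lam x F := by
  induction n using Nat.strong_induction_on with
  | _ n ih =>
  intro A C hn hCN F hF
  induction hm : (Finset.univ : Finset (Sym2 V)).card - F.card using Nat.strong_induction_on
    generalizing F with
  | _ m ihm =>
  by_contra hneg
  push Not at hneg
  have hnc : ¬ LevelClosed lev F := fun h => absurd (slack_nonneg_of_levelClosed hx h) (by linarith)
  unfold LevelClosed at hnc
  push Not at hnc
  obtain ⟨a, c, hac⟩ := hnc
  have hsupp : ∀ w ∈ edgeSpan F, w ∈ zeroSumOn (levelsIn lev A C) := fun w hw => by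
    rw [← edgeSpan_pairsIn]
    exact edgeSpan_mono hF hw
  have hac' : ¬ edgeSpan F ⊓ zeroSumOn (levelsIn lev (max a A) (min c C)) ≤
      edgeSpan (F ∩ pairsIn lev (max a A) (min c C)) := by
    refine fun h => hac fun w hw => ?_
    refine edgeSpan_mono (Finset.inter_subset_inter_left
      (pairsIn_mono (le_max_left _ _) (min_le_left _ _))) (h ⟨hw.1, fun v hv => ?_, hw.2.2⟩)
    by_cases h1 : v ∈ levelsIn lev a c
    · refine (hsupp w hw.1).1 v fun h2 => hv ?_
      rw [mem_levelsIn] at *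
      omega
    · exact hw.2.1 v h1
  have hlt : max a A < min c C := by
    by_contra hcon
    refine hac' fun w hw => ?_
    have : w = 0 := by
      ext v
      exact hw.2.1 v fun hm => by rw [mem_levelsIn] at hm; omega
    rw [this]
    exact zero_mem _
  have hne : min c C - max a A < n := by
    by_contra hcon
    have h1 : max a A = A := by omega
    have h2 : min c C = C := by omega
    rw [h1, h2, Finset.inter_eq_left.2 hF] at hac'
    exact hac' inf_le_left
  obtain ⟨h1, h2⟩ := slack_union_neg hx hneg hlt (by omega)
    (ih _ hne _ _ rfl (by omega) _ Finset.inter_subset_right) hac'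
  have h3 := Finset.card_lt_card h2
  have h4 := Finset.card_le_univ (F ∪ pairsIn lev (max a A) (min c C))
  rw [← Finset.card_univ] at h4
  have := ihm _ (by omega) (F ∪ pairsIn lev (max a A) (min c C))
    (Finset.union_subset hF (pairsIn_mono (le_max_right _ _) (min_le_right _ _))) rfl
  linarith

/-- The rank inequality underlying the splitting of a layered point. -/
theorem LayeredPoint.sum_le {lev : V → ℕ} {N : ℕ} {lam : ℝ} {x : Sym2 V → ℝ}
    (hx : LayeredPoint lev N lam x) (F : Finset (Sym2 V)) :
    ∑ e ∈ F, x e ≤ (1 - lam) * edgeRank F + lam * layerRank lev N F := by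
  have := slack_nonneg_of_subset_pairsIn hx (N - 0) 0 N rfl le_rfl F
    (Finset.inter_eq_left.1 (inter_pairsIn_eq hx.lev_lt F))
  unfold slack at this
  linarith

/-! ### Spanning trees -/

theorem edgeRank_union_le (F H : Finset (Sym2 V)) :
    edgeRank (F ∪ H) ≤ edgeRank F + edgeRank H :=
  le_trans (Nat.le_add_right _ _) (edgeRank_union_add_inter_le F H)

theorem edgeRank_le_card (F : Finset (Sym2 V)) : edgeRank F ≤ F.card := by
  have h := finrank_span_finset_le_card (R := ℝ) (F.image edgeVec)
  rw [Finset.coe_image] at h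
  exact le_trans h Finset.card_image_le

theorem edgeSpan_eq_of_connected {T : Finset (Sym2 V)}
    (hT : (SimpleGraph.fromEdgeSet (T : Set (Sym2 V))).Connected) :
    edgeSpan T = zeroSumOn Finset.univ := by
  refine le_antisymm (edgeSpan_le_zeroSumOn_univ T) (zeroSumOn_le fun u hu v hv => ?_)
  clear hu hv
  obtain ⟨p⟩ := hT.preconnected u v
  induction p with
  | nil => simp
  | @cons a b c h p ih =>
    rw [SimpleGraph.fromEdgeSet_adj] at h
    have h1 : (Pi.single a 1 - Pi.single b 1 : V → ℝ) ∈ edgeSpan T :=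
      single_sub_single_mem_edgeSpan (by exact_mod_cast h.1)
    have := add_mem h1 ih
    rwa [sub_add_sub_cancel] at this

theorem edgeFinset_fromEdgeSet {G : SimpleGraph V} {T : Finset (Sym2 V)}
    (h : (T : Set (Sym2 V)) ⊆ G.edgeSet) :
    (SimpleGraph.fromEdgeSet (T : Set (Sym2 V))).edgeSet = T := by
  rw [SimpleGraph.edgeSet_fromEdgeSet, sdiff_eq_left]
  refine Set.disjoint_left.2 fun e he hd => ?_
  exact G.not_isDiag_of_mem_edgeSet (h he) hd

theorem IsSpanningTree.card_add_one {G : SimpleGraph V} {T : Finset (Sym2 V)}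
    (hT : IsSpanningTree G T) : T.card + 1 = Fintype.card V := by
  have h := (SimpleGraph.isTree_iff_connected_and_card.1 hT.2).2
  rw [edgeFinset_fromEdgeSet hT.1] at h
  simpa using h

theorem IsSpanningTree.card_le_edgeRank {G : SimpleGraph V} {T : Finset (Sym2 V)}
    (hT : IsSpanningTree G T) : T.card ≤ edgeRank T := by
  have h1 := hT.card_add_one
  have h2 := card_le_finrank_zeroSumOn_univ_add_one (V := V)
  rw [← edgeSpan_eq_of_connected hT.2.connected] at h2
  unfold edgeRank
  omega

theorem IsSpanningTree.card_inter_le {G : SimpleGraph V} {T : Finset (Sym2 V)}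
    (hT : IsSpanningTree G T) (F : Finset (Sym2 V)) : (T ∩ F).card ≤ edgeRank F := by
  have h1 := hT.card_le_edgeRank
  have h2 := edgeRank_union_le (T ∩ F) (T \ F)
  have h3 := edgeRank_le_card (T \ F)
  have h4 : edgeRank (T ∩ F) ≤ edgeRank F := edgeRank_mono Finset.inter_subset_right
  have h5 := Finset.card_inter_add_card_sdiff T F
  have h6 : T ∩ F ∪ T \ F = T := by grind
  rw [h6] at h2
  omega

theorem isSpanningTree_of_rank [Nonempty V] {G : SimpleGraph V} {T : Finset (Sym2 V)}
    (hTG : (T : Set (Sym2 V)) ⊆ G.edgeSet) (hcard : T.card + 1 = Fintype.card V)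
    (hrank : Fintype.card V ≤ edgeRank T + 1) : IsSpanningTree G T := by
  refine ⟨hTG, SimpleGraph.isTree_iff_connected_and_card.2 ⟨⟨fun u v => ?_⟩, ?_⟩⟩
  · by_contra huv
    have h1 : edgeSpan T = zeroSumOn Finset.univ := by
      refine Submodule.eq_of_le_of_finrank_le (edgeSpan_le_zeroSumOn_univ T) ?_
      have := finrank_zeroSumOn_add_one_le (Finset.univ_nonempty (α := V))
      rw [Finset.card_univ] at this
      unfold edgeRank at hrank
      omega
    set H := SimpleGraph.fromEdgeSet (T : Set (Sym2 V)) with hH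
    let f : (V → ℝ) →ₗ[ℝ] ℝ := ∑ w ∈ Finset.univ.filter (fun w => H.Reachable u w),
      LinearMap.proj (R := ℝ) (φ := fun _ : V => ℝ) w
    have hf : ∀ a, f (Pi.single a 1 : V → ℝ) = if H.Reachable u a then 1 else 0 := by
      intro a
      simp only [f, LinearMap.sum_apply, LinearMap.proj_apply]
      rw [Finset.sum_filter, Finset.sum_eq_single a]
      · simp
      · intro w _ hw; simp [hw]
      · simp
    have h2 : edgeSpan T ≤ LinearMap.ker f := by
      refine edgeSpan_le fun a b hab => ?_
      rw [LinearMap.mem_ker, map_sub, hf, hf]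
      by_cases h : a = b
      · rw [h, sub_self]
      · have hadj : H.Adj a b := by
          rw [hH, SimpleGraph.fromEdgeSet_adj]
          exact ⟨by exact_mod_cast hab, h⟩
        have : H.Reachable u a ↔ H.Reachable u b :=
          ⟨fun h => h.trans hadj.reachable, fun h => h.trans hadj.symm.reachable⟩
        simp [this]
    have h3 := h2 (h1 ▸ single_sub_single_mem_zeroSumOn (Finset.mem_univ u) (Finset.mem_univ v))
    rw [LinearMap.mem_ker, map_sub, hf, hf, if_pos (SimpleGraph.Reachable.refl u), if_neg huv] at h3
    norm_num at h3
  · rw [edgeFinset_fromEdgeSet hTG]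
    simpa using hcard

theorem sum_chi (T F : Finset (Sym2 V)) : ∑ e ∈ F, chi T e = (T ∩ F).card := by
  simp only [chi]
  rw [Finset.sum_ite_mem, Finset.inter_comm]
  simp

/-- The constraints of the spanning tree polytope, in terms of the graphic rank. -/
structure TreePoint (G : SimpleGraph V) (y : Sym2 V → ℝ) : Prop where
  nonneg : ∀ e, 0 ≤ y e
  eq_zero : ∀ e, e ∉ G.edgeFinset → y e = 0
  sum_le : ∀ F : Finset (Sym2 V), ∑ e ∈ F, y e ≤ edgeRank F
  total : ∑ e, y e = (Fintype.card V : ℝ) - 1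

theorem treePoint_of_mem {G : SimpleGraph V} {y : Sym2 V → ℝ}
    (hy : y ∈ spanningTreePolytope G) : TreePoint G y := by
  have hconv : Convex ℝ {y : Sym2 V → ℝ | TreePoint G y} := by
    intro a ha b hb s t hs ht hst
    refine ⟨fun e => ?_, fun e he => ?_, fun F => ?_, ?_⟩
    · have := ha.nonneg e
      have := hb.nonneg e
      simp only [Pi.add_apply, Pi.smul_apply, smul_eq_mul]
      positivity
    · simp [ha.eq_zero e he, hb.eq_zero e he]
    · simp only [Pi.add_apply, Pi.smul_apply, smul_eq_mul, Finset.sum_add_distrib,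
        ← Finset.mul_sum]
      nlinarith [mul_le_mul_of_nonneg_left (ha.sum_le F) hs,
        mul_le_mul_of_nonneg_left (hb.sum_le F) ht]
    · simp only [Pi.add_apply, Pi.smul_apply, smul_eq_mul, Finset.sum_add_distrib,
        ← Finset.mul_sum, ha.total, hb.total]
      rw [← add_mul, hst, one_mul]
  refine convexHull_min ?_ hconv hy
  rintro _ ⟨T, hT, rfl⟩
  refine ⟨fun e => ?_, fun e he => ?_, fun F => ?_, ?_⟩
  · unfold chi; split_ifs <;> simp
  · unfold chi
    rw [if_neg]
    intro heT
    exact he (SimpleGraph.mem_edgeFinset.2 (hT.1 heT))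
  · rw [sum_chi]
    exact_mod_cast hT.card_inter_le F
  · rw [sum_chi, Finset.inter_univ, ← hT.card_add_one]
    push_cast
    ring

/-! ### Degree sums and cuts -/

/-- The sum of the degrees of the vertices of `U` with respect to the weight `y`. -/
noncomputable def degSum (G : SimpleGraph V) (U : Finset V) (y : Sym2 V → ℝ) : ℝ :=
  ∑ v ∈ U, ∑ e ∈ cut G {v}, y e

theorem mk_mem_cut {G : SimpleGraph V} {S : Finset V} {u v : V} :
    s(u, v) ∈ cut G S ↔ s(u, v) ∈ G.edgeFinset ∧ ¬ (u ∈ S ↔ v ∈ S) := by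
  simp only [cut, cutBetween, Finset.mem_filter, Finset.mem_compl]
  refine and_congr_right fun _ => ⟨?_, fun h => ?_⟩
  · rintro ⟨a, b, hab, ha, hb⟩
    rw [Sym2.eq_iff] at hab
    rcases hab with ⟨rfl, rfl⟩ | ⟨rfl, rfl⟩ <;> tauto
  · by_cases hu : u ∈ S
    · exact ⟨u, v, rfl, hu, by tauto⟩
    · exact ⟨v, u, Sym2.eq_swap, by tauto, hu⟩

theorem mk_mem_inducedEdges {G : SimpleGraph V} {S : Finset V} {u v : V} :
    s(u, v) ∈ inducedEdges G S ↔ s(u, v) ∈ G.edgeFinset ∧ u ∈ S ∧ v ∈ S := by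
  simp [inducedEdges]

theorem sum_eq_sum_univ_ite {F : Finset (Sym2 V)} (y : Sym2 V → ℝ) :
    ∑ e ∈ F, y e = ∑ e, if e ∈ F then y e else 0 := by
  rw [Finset.sum_ite_mem, Finset.univ_inter]

theorem degSum_eq (G : SimpleGraph V) (U : Finset V) (y : Sym2 V → ℝ) :
    degSum G U y = 2 * ∑ e ∈ inducedEdges G U, y e + ∑ e ∈ cut G U, y e := by
  unfold degSum
  rw [sum_eq_sum_univ_ite (F := inducedEdges G U),
    sum_eq_sum_univ_ite (F := cut G U)]
  simp_rw [sum_eq_sum_univ_ite (F := cut G _)]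
  rw [Finset.sum_comm, Finset.mul_sum, ← Finset.sum_add_distrib]
  refine Finset.sum_congr rfl fun e _ => ?_
  induction e using Sym2.ind with
  | _ a b =>
    simp only [mk_mem_cut, mk_mem_inducedEdges, Finset.mem_singleton]
    by_cases he : s(a, b) ∈ G.edgeFinset
    · have hab : a ≠ b := by
        rintro rfl
        simp at he
      have h1 : ∀ v, (if s(a, b) ∈ G.edgeFinset ∧ ¬ (a = v ↔ b = v) then y s(a, b) else 0) =
          (if v = a then y s(a, b) else 0) + (if v = b then y s(a, b) else 0) := by
        intro v
        by_cases ha : v = a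
        · subst ha; simp [he, hab, hab.symm]
        · by_cases hb : v = b
          · subst hb; simp [he, hab, hab.symm]
          · simp [ha, hb, Ne.symm ha, Ne.symm hb]
      simp_rw [h1]
      rw [Finset.sum_add_distrib, Finset.sum_ite_eq', Finset.sum_ite_eq']
      by_cases ha : a ∈ U <;> by_cases hb : b ∈ U <;> simp [he, ha, hb]
      ring
    · simp [he]

theorem degSum_union (G : SimpleGraph V) {U W : Finset V} (h : Disjoint U W) (y : Sym2 V → ℝ) :
    degSum G (U ∪ W) y = degSum G U y + degSum G W y :=
  Finset.sum_union h

theorem TreePoint.sum_eq_sum {G : SimpleGraph V} {y : Sym2 V → ℝ} (hy : TreePoint G y)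
    {F H : Finset (Sym2 V)} (h : ∀ e ∈ G.edgeFinset, e ∈ F ↔ e ∈ H) :
    ∑ e ∈ F, y e = ∑ e ∈ H, y e := by
  rw [sum_eq_sum_univ_ite (F := F), sum_eq_sum_univ_ite (F := H)]
  refine Finset.sum_congr rfl fun e _ => ?_
  by_cases he : e ∈ G.edgeFinset
  · simp only [h e he]
  · simp [hy.eq_zero e he]

theorem edgeRank_inducedEdges_add_one_le (G : SimpleGraph V) {U : Finset V} (hU : U.Nonempty) :
    edgeRank (inducedEdges G U) + 1 ≤ U.card := by
  have h1 : edgeSpan (inducedEdges G U) ≤ zeroSumOn U := edgeSpan_le fun u v huv => by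
    rw [mk_mem_inducedEdges] at huv
    exact single_sub_single_mem_zeroSumOn huv.2.1 huv.2.2
  have h2 := Submodule.finrank_mono h1
  have h3 := finrank_zeroSumOn_add_one_le hU
  unfold edgeRank
  omega

theorem TreePoint.total_eq {G : SimpleGraph V} {y : Sym2 V → ℝ} (hy : TreePoint G y)
    (U : Finset V) :
    ∑ e, y e = ∑ e ∈ inducedEdges G U, y e + ∑ e ∈ inducedEdges G Uᶜ, y e +
      ∑ e ∈ cut G U, y e := by
  rw [sum_eq_sum_univ_ite (F := inducedEdges G U),
    sum_eq_sum_univ_ite (F := inducedEdges G Uᶜ),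
    sum_eq_sum_univ_ite (F := cut G U), ← Finset.sum_add_distrib,
    ← Finset.sum_add_distrib]
  refine Finset.sum_congr rfl fun e _ => ?_
  by_cases he : e ∈ G.edgeFinset
  · induction e using Sym2.ind with
    | _ a b =>
      simp only [mk_mem_cut, mk_mem_inducedEdges, Finset.mem_compl]
      by_cases ha : a ∈ U <;> by_cases hb : b ∈ U <;> simp [he, ha, hb]
  · simp [hy.eq_zero e he]

theorem TreePoint.degSum_eq_of_cut_eq_one {G : SimpleGraph V} {y : Sym2 V → ℝ}
    (hy : TreePoint G y) {U : Finset V} (hU : U.Nonempty) (hU' : Uᶜ.Nonempty)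
    (hcut : ∑ e ∈ cut G U, y e = 1) : degSum G U y = 2 * (U.card : ℝ) - 1 := by
  have h1 : ((edgeRank (inducedEdges G U) : ℕ) : ℝ) + 1 ≤ U.card := by
    exact_mod_cast edgeRank_inducedEdges_add_one_le G hU
  have h2 : ((edgeRank (inducedEdges G Uᶜ) : ℕ) : ℝ) + 1 ≤ Uᶜ.card := by
    exact_mod_cast edgeRank_inducedEdges_add_one_le G hU'
  have h3 := hy.sum_le (inducedEdges G U)
  have h4 := hy.sum_le (inducedEdges G Uᶜ)
  have h5 := hy.total_eq U
  have h6 : (U.card : ℝ) + (Uᶜ.card : ℝ) = Fintype.card V := by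
    exact_mod_cast Finset.card_add_card_compl U
  rw [hy.total] at h5
  rw [degSum_eq, hcut]
  linarith

/-! ### Level functions satisfying the degree conditions -/

theorem mem_cut_levelsIn {G : SimpleGraph V} {lev : V → ℕ} {b : ℕ} {e : Sym2 V} :
    e ∈ cut G (levelsIn lev 0 b) ↔
      e ∈ G.edgeFinset ∧ lowLevel lev e < b ∧ b ≤ highLevel lev e := by
  induction e using Sym2.ind with
  | _ u v =>
    rw [mk_mem_cut, mem_levelsIn, mem_levelsIn, lowLevel_mk, highLevel_mk]
    refine and_congr_right fun _ => ?_
    omega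

theorem mem_inducedEdges_levelsIn {G : SimpleGraph V} {lev : V → ℕ} {b : ℕ} {e : Sym2 V} :
    e ∈ inducedEdges G (levelsIn lev 0 b) ↔ e ∈ G.edgeFinset ∧ e ∈ pairsIn lev 0 b := by
  induction e using Sym2.ind with
  | _ u v =>
    rw [mk_mem_inducedEdges, mem_levelsIn, mem_levelsIn, mem_pairsIn, lowLevel_mk, highLevel_mk]
    refine and_congr_right fun _ => ?_
    omega

theorem sum_pairsIn_add_sum_jump (lev : V → ℕ) (y : Sym2 V → ℝ) {a c : ℕ} (hac : a ≤ c) :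
    ∑ e ∈ pairsIn lev 0 c, y e +
        ∑ e ∈ Finset.univ.filter (fun e => lowLevel lev e < a ∧ c ≤ highLevel lev e), y e =
      ∑ e ∈ pairsIn lev 0 a, y e + ∑ e ∈ pairsIn lev a c, y e +
        ∑ e ∈ Finset.univ.filter (fun e => lowLevel lev e < a ∧ a ≤ highLevel lev e), y e := by
  simp only [pairsIn, Finset.sum_filter]
  rw [← Finset.sum_add_distrib, ← Finset.sum_add_distrib, ← Finset.sum_add_distrib]
  refine Finset.sum_congr rfl fun e _ => ?_
  have := lowLevel_le_highLevel lev e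
  by_cases h1 : highLevel lev e < a
  · have h2 : highLevel lev e < c := by omega
    simp [h1, h2, show ¬ c ≤ highLevel lev e by omega, show ¬ a ≤ highLevel lev e by omega,
      show ¬ a ≤ lowLevel lev e by omega]
  · by_cases h2 : highLevel lev e < c <;> by_cases h3 : lowLevel lev e < a <;>
      simp [h1, h2, h3, not_lt.1 h1, not_lt.1] <;> grind

theorem card_levelsIn_add (lev : V → ℕ) {a c : ℕ} (hac : a ≤ c) :
    (levelsIn lev 0 a).card + (levelsIn lev a c).card = (levelsIn lev 0 c).card := by
  rw [← Finset.card_union_of_disjoint]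
  · congr 1
    ext v
    simp only [Finset.mem_union, mem_levelsIn]
    omega
  · refine Finset.disjoint_left.2 fun v h1 h2 => ?_
    rw [mem_levelsIn] at h1 h2
    omega

theorem TreePoint.layeredPoint {G : SimpleGraph V} {y : Sym2 V → ℝ} (hy : TreePoint G y)
    {lev : V → ℕ} {N : ℕ} {lam : ℝ} (hlev : ∀ v, lev v < N) (hex : ∀ b < N, ∃ v, lev v = b)
    (hlam : 0 < lam) (hlam1 : lam ≤ 1)
    (hcut : ∀ b, 0 < b → b < N → ∑ e ∈ cut G (levelsIn lev 0 b), y e ≤ 2 - lam)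
    (hdeg : ∀ b, 0 < b → b < N →
      degSum G (levelsIn lev 0 b) y = 2 * ((levelsIn lev 0 b).card : ℝ) - 1) :
    LayeredPoint lev N lam y := by
  have hcut' : ∀ b, ∑ e ∈ cut G (levelsIn lev 0 b), y e =
      ∑ e ∈ Finset.univ.filter (fun e => lowLevel lev e < b ∧ b ≤ highLevel lev e), y e := by
    intro b
    refine hy.sum_eq_sum fun e he => ?_
    simp [mem_cut_levelsIn, he]
  have hind : ∀ b, ∑ e ∈ inducedEdges G (levelsIn lev 0 b), y e = ∑ e ∈ pairsIn lev 0 b, y e := by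
    intro b
    refine hy.sum_eq_sum fun e he => ?_
    simp [mem_inducedEdges_levelsIn, he]
  simp only [degSum_eq, hind, hcut'] at hdeg hcut
  have hhigh : ∀ e, highLevel lev e < N := by
    intro e
    induction e using Sym2.ind with
    | _ u v => have := hlev u; have := hlev v; simp; omega
  have htot : ∑ e ∈ pairsIn lev 0 N, y e = (Fintype.card V : ℝ) - 1 := by
    rw [← hy.total]
    congr 1
    ext e
    simp [mem_pairsIn, hhigh e]
  have hcard : (levelsIn lev 0 N).card = Fintype.card V := by
    rw [← Finset.card_univ]
    congr 1
    ext v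
    simp [mem_levelsIn, hlev v]
  have hJ : ∀ a c : ℕ,
      0 ≤ ∑ e ∈ Finset.univ.filter (fun e => lowLevel lev e < a ∧ c ≤ highLevel lev e), y e :=
    fun a c => Finset.sum_nonneg fun e _ => hy.nonneg e
  refine ⟨hlev, hex, hy.nonneg, hlam, hlam1, hy.sum_le, fun a c hac hc => ?_, hcut, fun b => ?_⟩
  · have hcc : ((levelsIn lev 0 a).card : ℝ) + (levelsIn lev a c).card = (levelsIn lev 0 c).card := by
      exact_mod_cast card_levelsIn_add lev hac.le
    have key := sum_pairsIn_add_sum_jump lev y hac.le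
    rcases Nat.eq_zero_or_pos a with rfl | ha
    · rcases hc.eq_or_lt with rfl | hc
      · rw [htot, hcard]; linarith
      · have := hcut c hac hc
        have := hdeg c hac hc
        linarith
    · have g1 := hcut a ha (by omega)
      have g2 := hdeg a ha (by omega)
      rcases hc.eq_or_lt with rfl | hc
      · have h0 : ∑ e ∈ Finset.univ.filter
            (fun e => lowLevel lev e < a ∧ c ≤ highLevel lev e), y e = 0 := by
          rw [Finset.filter_false_of_mem, Finset.sum_empty]
          intro e _ h
          have := hhigh e
          omega
        rw [hcard] at hcc
        linarith
      · have := hcut c (by omega) hc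
        have := hdeg c (by omega) hc
        have := hJ a c
        linarith
  · by_cases hb : 0 < b ∧ b + 1 < N
    · have key := sum_pairsIn_add_sum_jump lev y (Nat.le_succ b)
      have g1 := hcut b hb.1 (by omega)
      have g2 := hdeg b hb.1 (by omega)
      have g3 := hcut (b + 1) (by omega) hb.2
      have g4 := hdeg (b + 1) (by omega) hb.2
      have hcc : ((levelsIn lev 0 b).card : ℝ) + (levelsIn lev b (b + 1)).card =
          (levelsIn lev 0 (b + 1)).card := by
        exact_mod_cast card_levelsIn_add lev (Nat.le_succ b)
      have h1 := hy.sum_le (pairsIn lev b (b + 1))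
      have h2 : (edgeRank (pairsIn lev b (b + 1)) : ℝ) + 1 ≤ (levelsIn lev b (b + 1)).card := by
        obtain ⟨v, hv⟩ := hex b (by omega)
        have := finrank_zeroSumOn_add_one_le (p := levelsIn lev b (b + 1))
          ⟨v, mem_levelsIn.2 (by omega)⟩
        rw [← edgeSpan_pairsIn] at this
        exact_mod_cast this
      simp only [Nat.succ_eq_add_one, Nat.add_one_le_iff] at key g3 g4
      linarith
    · rw [Finset.filter_false_of_mem, Finset.sum_empty]
      · linarith
      · intro e _ h
        have := hhigh e
        omega

/-! ### Greedy independent sets -/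

theorem edgeSpan_insert (e : Sym2 V) (F : Finset (Sym2 V)) :
    edgeSpan (insert e F) = Submodule.span ℝ {edgeVec e} ⊔ edgeSpan F := by
  rw [Finset.insert_eq, edgeSpan_union]
  simp [edgeSpan]

theorem exists_greedy (c : Sym2 V → ℝ) (F : Finset (Sym2 V)) :
    ∃ I ⊆ F, edgeSpan I = edgeSpan F ∧ I.card = edgeRank I ∧
      ∀ t, edgeRank (F.filter fun e => t ≤ c e) ≤ (I.filter fun e => t ≤ c e).card := by
  induction F using Finset.induction_on_min_value c with
  | empty =>
    have h := edgeRank_le_card (∅ : Finset (Sym2 V))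
    exact ⟨∅, subset_rfl, rfl, le_antisymm (by simp) h, fun t => edgeRank_le_card _⟩
  | insert a s ha hmin ih =>
    obtain ⟨I, hI, hspan, hcard, hgreedy⟩ := ih
    have main : ∀ J ⊆ insert a s, I ⊆ J → edgeSpan J = edgeSpan (insert a s) →
        J.card = edgeRank J → ∃ I ⊆ insert a s, edgeSpan I = edgeSpan (insert a s) ∧
          I.card = edgeRank I ∧ ∀ t, edgeRank ((insert a s).filter fun e => t ≤ c e) ≤
            (I.filter fun e => t ≤ c e).card := by
      intro J hJ hIJ hJs hJc
      refine ⟨J, hJ, hJs, hJc, fun t => ?_⟩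
      by_cases ht : t ≤ c a
      · have hall : ∀ e ∈ insert a s, t ≤ c e := by
          intro e he
          rcases Finset.mem_insert.1 he with rfl | he
          · exact ht
          · exact ht.trans (hmin e he)
        rw [Finset.filter_true_of_mem hall, Finset.filter_true_of_mem fun e he => hall e (hJ he),
          hJc]
        unfold edgeRank
        rw [hJs]
      · rw [Finset.filter_insert, if_neg ht]
        exact (hgreedy t).trans (Finset.card_le_card (Finset.filter_subset_filter _ hIJ))
    by_cases hmem : edgeVec a ∈ edgeSpan s
    · have h1 : edgeSpan (insert a s) = edgeSpan s := by
        rw [edgeSpan_insert, sup_eq_right, Submodule.span_singleton_le_iff_mem]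
        exact hmem
      exact main I (hI.trans (Finset.subset_insert _ _)) subset_rfl (by rw [hspan, h1]) hcard
    · have h1 : edgeSpan (insert a I) = edgeSpan (insert a s) := by
        rw [edgeSpan_insert, edgeSpan_insert, hspan]
      refine main (insert a I) (Finset.insert_subset_insert _ hI) (Finset.subset_insert _ _) h1 ?_
      refine le_antisymm ?_ (edgeRank_le_card _)
      rw [Finset.card_insert_of_notMem fun h => ha (hI h), hcard, Nat.add_one_le_iff]
      refine Submodule.finrank_lt_finrank_of_lt (lt_of_le_of_ne
        (edgeSpan_mono (Finset.subset_insert _ _)) fun h => hmem ?_)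
      rw [← hspan, h]
      exact Submodule.subset_span ⟨a, by simp, rfl⟩

theorem sum_sub_mul_nonneg {α : Type*} (c z : α → ℝ) (s : Finset α) :
    ∀ m : ℝ, (∀ e ∈ s, m < c e) → (∀ t, m < t → 0 ≤ ∑ e ∈ s.filter (fun e => t ≤ c e), z e) →
      0 ≤ ∑ e ∈ s, (c e - m) * z e := by
  induction s using Finset.strongInduction with
  | H s ih =>
    intro m hm ht
    rcases s.eq_empty_or_nonempty with rfl | hs
    · simp
    obtain ⟨a, ha, hmin⟩ := s.exists_min_image c hs
    have h1 := ih (s.filter fun e => c a < c e)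
      (Finset.filter_ssubset.2 ⟨a, ha, lt_irrefl _⟩) (c a) (by simp) (fun t hta => by
        have := ht t ((hm a ha).trans hta)
        rw [Finset.filter_filter]
        convert this using 3
        simp only [and_iff_right_iff_imp]
        exact fun h => hta.trans_le h)
    have h2 : ∑ e ∈ s.filter (fun e => c a < c e), (c e - c a) * z e =
        ∑ e ∈ s, (c e - c a) * z e := by
      refine Finset.sum_filter_of_ne fun e he hne => lt_of_le_of_ne (hmin e he) fun h => hne ?_
      rw [h, sub_self, zero_mul]
    have h3 := ht (c a) (hm a ha)
    rw [Finset.filter_true_of_mem hmin] at h3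
    have h4 : ∑ e ∈ s, (c e - m) * z e =
        ∑ e ∈ s, (c e - c a) * z e + (c a - m) * ∑ e ∈ s, z e := by
      rw [Finset.mul_sum, ← Finset.sum_add_distrib]
      exact Finset.sum_congr rfl fun e _ => by ring
    rw [h4, ← h2]
    have := mul_nonneg (sub_nonneg.2 (hm a ha).le) h3
    linarith

theorem sum_mul_nonneg_of_threshold {α : Type*} (c z : α → ℝ) (s : Finset α)
    (hz : ∑ e ∈ s, z e = 0) (ht : ∀ t, 0 ≤ ∑ e ∈ s.filter (fun e => t ≤ c e), z e) :
    0 ≤ ∑ e ∈ s, c e * z e := by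
  rcases s.eq_empty_or_nonempty with rfl | hs
  · simp
  obtain ⟨a, ha, hmin⟩ := s.exists_min_image c hs
  have h := sum_sub_mul_nonneg c z s (c a - 1)
    (fun e he => by have := hmin e he; linarith) (fun t _ => ht t)
  simp only [sub_mul _ (c a - 1), Finset.sum_sub_distrib, ← Finset.mul_sum, hz] at h
  simpa using h

/-! ### Greedy spanning trees and greedy Gao-trees -/

theorem TreePoint.sum_edgeFinset {G : SimpleGraph V} {y : Sym2 V → ℝ} (hy : TreePoint G y) :
    ∑ e ∈ G.edgeFinset, y e = (Fintype.card V : ℝ) - 1 := by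
  rw [← hy.total]
  exact Finset.sum_subset (Finset.subset_univ _) fun e _ he => hy.eq_zero e he

theorem TreePoint.edgeRank_edgeFinset [Nonempty V] {G : SimpleGraph V} {y : Sym2 V → ℝ}
    (hy : TreePoint G y) : edgeRank G.edgeFinset + 1 = Fintype.card V := by
  refine le_antisymm (edgeRank_add_one_le _) ?_
  have h := hy.sum_le G.edgeFinset
  rw [hy.sum_edgeFinset, sub_le_iff_le_add] at h
  exact_mod_cast h

theorem TreePoint.exists_greedy_tree [Nonempty V] {G : SimpleGraph V} {y : Sym2 V → ℝ}
    (hy : TreePoint G y) (c : Sym2 V → ℝ) :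
    ∃ T, IsSpanningTree G T ∧ ∀ t,
      edgeRank (G.edgeFinset.filter fun e => t ≤ c e) ≤ (T.filter fun e => t ≤ c e).card := by
  obtain ⟨T, hTE, hspan, hcard, hgreedy⟩ := exists_greedy c G.edgeFinset
  have h1 : edgeRank T = edgeRank G.edgeFinset := by unfold edgeRank; rw [hspan]
  have h2 := hy.edgeRank_edgeFinset
  refine ⟨T, isSpanningTree_of_rank (fun e he => ?_) (by omega) (by omega), hgreedy⟩
  exact SimpleGraph.mem_edgeFinset.1 (hTE he)

theorem exists_greedy_gap (lev : V → ℕ) (c : Sym2 V → ℝ) (F : Finset (Sym2 V)) (b : ℕ) :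
    ∃ J ⊆ F.filter (fun e => lowLevel lev e + 1 = b ∧ highLevel lev e = b),
      J.card = gapHit lev F b ∧
      ∀ t, gapHit lev (F.filter fun e => t ≤ c e) b ≤ (J.filter fun e => t ≤ c e).card := by
  set K := F.filter (fun e => lowLevel lev e + 1 = b ∧ highLevel lev e = b) with hK
  rcases K.eq_empty_or_nonempty with h | h
  · have h0 : ∀ H ⊆ F, gapHit lev H b = 0 := by
      intro H hH
      unfold gapHit
      rw [if_neg]
      rintro ⟨e, he, h1⟩
      have : e ∈ K := Finset.mem_filter.2 ⟨hH he, h1⟩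
      simp [h] at this
    exact ⟨∅, Finset.empty_subset _, by rw [h0 F subset_rfl, Finset.card_empty],
      fun t => by rw [h0 _ (Finset.filter_subset _ _)]; exact Nat.zero_le _⟩
  · obtain ⟨g, hg, hmax⟩ := K.exists_max_image c h
    have hg' := (Finset.mem_filter.1 hg)
    refine ⟨{g}, Finset.singleton_subset_iff.2 hg, ?_, fun t => ?_⟩
    · rw [gapHit_pos hg'.1 hg'.2.1 hg'.2.2, Finset.card_singleton]
    · by_cases ht : t ≤ c g
      · rw [Finset.filter_singleton, if_pos ht, Finset.card_singleton]
        exact gapHit_le_one _ _ _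
      · unfold gapHit
        rw [if_neg]
        · exact Nat.zero_le _
        · rintro ⟨e, he, h1⟩
          rw [Finset.mem_filter] at he
          exact ht (he.2.trans (hmax e (Finset.mem_filter.2 ⟨he.1, h1⟩)))

theorem sum_card_levelsIn (lev : V → ℕ) (N : ℕ) :
    ∑ b ∈ Finset.range N, (levelsIn lev b (b + 1)).card = (levelsIn lev 0 N).card := by
  induction N with
  | zero => simp [levelsIn]
  | succ N ih => rw [Finset.sum_range_succ, ih, card_levelsIn_add lev (Nat.le_succ N)]

theorem card_levelsIn_zero {lev : V → ℕ} {N : ℕ} (hlev : ∀ v, lev v < N) :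
    (levelsIn lev 0 N).card = Fintype.card V := by
  rw [← Finset.card_univ]
  congr 1
  ext v
  simp [mem_levelsIn, hlev v]

theorem layer_term_le {lev : V → ℕ} {b : ℕ} (hb : ∃ v, lev v = b) (F : Finset (Sym2 V)) :
    edgeRank (F ∩ pairsIn lev b (b + 1)) + gapHit lev F b + (if b = 0 then 1 else 0) ≤
      (levelsIn lev b (b + 1)).card := by
  obtain ⟨v, hv⟩ := hb
  have h1 := finrank_zeroSumOn_add_one_le (p := levelsIn lev b (b + 1))
    ⟨v, mem_levelsIn.2 (by omega)⟩
  have h2 := Submodule.finrank_mono (edgeSpan_inter_pairsIn_le lev F b (b + 1))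
  have h3 := gapHit_le_one lev F b
  unfold edgeRank
  split_ifs with h0
  · have h4 : gapHit lev F b = 0 := by
      by_contra h
      obtain ⟨_, _, _, h5, _⟩ := exists_of_gapHit h
      omega
    omega
  · omega

theorem LayeredPoint.layerRank_edgeFinset_add_one {G : SimpleGraph V} {lev : V → ℕ} {N : ℕ} {lam : ℝ}
    {y : Sym2 V → ℝ} [Nonempty V] (hx : LayeredPoint lev N lam y) (hy : TreePoint G y) :
    layerRank lev N G.edgeFinset + 1 = Fintype.card V := by
  have h1 := layerRank_le_edgeRank hx.lev_lt G.edgeFinset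
  have h2 := hy.edgeRank_edgeFinset
  refine le_antisymm (by omega) ?_
  have h3 := hx.sum_le G.edgeFinset
  have h4 : (edgeRank G.edgeFinset : ℝ) + 1 = Fintype.card V := by exact_mod_cast h2
  rw [hy.sum_edgeFinset] at h3
  have h5 : lam * (edgeRank G.edgeFinset : ℝ) ≤ lam * layerRank lev N G.edgeFinset := by
    linarith
  have h6 := le_of_mul_le_mul_left h5 hx.lam_pos
  have h7 : edgeRank G.edgeFinset ≤ layerRank lev N G.edgeFinset := by exact_mod_cast h6
  omega

theorem LayeredPoint.gapHit_edgeFinset {G : SimpleGraph V} {lev : V → ℕ} {N : ℕ} {lam : ℝ}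
    {y : Sym2 V → ℝ} [Nonempty V] (hx : LayeredPoint lev N lam y) (hy : TreePoint G y)
    {b : ℕ} (hb : 0 < b) (hbN : b < N) : gapHit lev G.edgeFinset b = 1 := by
  have h1 := hx.layerRank_edgeFinset_add_one hy
  have hterm : ∀ b ∈ Finset.range N, _ := fun b hb =>
    layer_term_le (hx.exists_lev b (Finset.mem_range.1 hb)) G.edgeFinset
  have hsum : ∑ b ∈ Finset.range N, (edgeRank (G.edgeFinset ∩ pairsIn lev b (b + 1)) +
      gapHit lev G.edgeFinset b + (if b = 0 then 1 else 0)) =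
      ∑ b ∈ Finset.range N, (levelsIn lev b (b + 1)).card := by
    rw [sum_card_levelsIn, card_levelsIn_zero hx.lev_lt, ← h1, Finset.sum_add_distrib,
      Finset.sum_ite_eq', if_pos (Finset.mem_range.2 (by omega))]
    rfl
  have h2 := (Finset.sum_eq_sum_iff_of_le hterm).1 hsum b (Finset.mem_range.2 hbN)
  rw [if_neg (by omega)] at h2
  have h3 := finrank_zeroSumOn_add_one_le (p := levelsIn lev b (b + 1))
    (by obtain ⟨v, hv⟩ := hx.exists_lev b hbN; exact ⟨v, mem_levelsIn.2 (by omega)⟩)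
  have h4 := Submodule.finrank_mono (edgeSpan_inter_pairsIn_le lev G.edgeFinset b (b + 1))
  have h5 := gapHit_le_one lev G.edgeFinset b
  unfold edgeRank at h2
  omega

theorem LayeredPoint.exists_greedy_gaoTree [Nonempty V] {G : SimpleGraph V} {lev : V → ℕ} {N : ℕ}
    {lam : ℝ} {y : Sym2 V → ℝ} (hx : LayeredPoint lev N lam y) (hy : TreePoint G y)
    (c : Sym2 V → ℝ) :
    ∃ T, IsSpanningTree G T ∧
      (∀ b, 0 < b → b < N → (T ∩ cut G (levelsIn lev 0 b)).card = 1) ∧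
      ∀ t, layerRank lev N (G.edgeFinset.filter fun e => t ≤ c e) ≤
        (T.filter fun e => t ≤ c e).card := by
  choose I hIsub hIspan hIcard hIgreedy using
    fun b => exists_greedy c (G.edgeFinset ∩ pairsIn lev b (b + 1))
  choose J hJsub hJcard hJgreedy using fun b => exists_greedy_gap lev c G.edgeFinset b
  have hI : ∀ b, ∀ e ∈ I b, e ∈ G.edgeFinset ∧ lowLevel lev e = b ∧ highLevel lev e = b := by
    intro b e he
    have h := hIsub b he
    rw [Finset.mem_inter, mem_pairsIn] at h
    have := lowLevel_le_highLevel lev e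
    exact ⟨h.1, by omega, by omega⟩
  have hJ : ∀ b, ∀ e ∈ J b, e ∈ G.edgeFinset ∧ lowLevel lev e + 1 = b ∧ highLevel lev e = b :=
    fun b e he => by simpa using hJsub b he
  have hcardP : ∀ P : Sym2 V → Prop,
      (((Finset.range N).biUnion fun b => I b ∪ J b).filter P).card =
        ∑ b ∈ Finset.range N, (((I b).filter P).card + ((J b).filter P).card) := by
    intro P
    rw [Finset.filter_biUnion, Finset.card_biUnion]
    · refine Finset.sum_congr rfl fun b _ => ?_
      rw [Finset.filter_union, Finset.card_union_of_disjoint]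
      refine Finset.disjoint_left.2 fun e h1 h2 => ?_
      have := hI b e (Finset.mem_filter.1 h1).1
      have := hJ b e (Finset.mem_filter.1 h2).1
      omega
    · intro b _ b' _ hbb
      refine Finset.disjoint_left.2 fun e h1 h2 => hbb ?_
      have key : ∀ b, e ∈ (I b ∪ J b).filter P → highLevel lev e = b := by
        intro b h
        rcases Finset.mem_union.1 (Finset.mem_filter.1 h).1 with h | h
        · exact (hI b e h).2.2
        · exact (hJ b e h).2.2
      rw [← key b h1, ← key b' h2]
  set T := (Finset.range N).biUnion fun b => I b ∪ J b with hT
  have hIT : ∀ b < N, I b ∪ J b ⊆ T := fun b hb =>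
    Finset.subset_biUnion_of_mem (fun b => I b ∪ J b) (Finset.mem_range.2 hb)
  have hIrank : ∀ b, edgeRank (I b) = edgeRank (G.edgeFinset ∩ pairsIn lev b (b + 1)) := by
    intro b
    unfold edgeRank
    rw [hIspan]
  have hTcard : T.card = layerRank lev N G.edgeFinset := by
    have := hcardP fun _ => True
    simp only [Finset.filter_true] at this
    rw [this]
    exact Finset.sum_congr rfl fun b _ => by rw [hIcard, hJcard, hIrank]
  have hTE : T ⊆ G.edgeFinset := by
    intro e he
    obtain ⟨b, _, hb⟩ := Finset.mem_biUnion.1 he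
    rcases Finset.mem_union.1 hb with h | h
    · exact (hI b e h).1
    · exact (hJ b e h).1
  have hTlayer : layerRank lev N G.edgeFinset ≤ layerRank lev N T := by
    refine Finset.sum_le_sum fun b hb => Nat.add_le_add ?_ ?_
    · rw [← hIrank]
      refine edgeRank_mono fun e he => Finset.mem_inter.2
        ⟨hIT b (Finset.mem_range.1 hb) (Finset.mem_union_left _ he),
          (Finset.mem_inter.1 (hIsub b he)).2⟩
    · rw [← hJcard]
      rcases (J b).eq_empty_or_nonempty with h | ⟨g, hg⟩
      · simp [h]
      · rw [gapHit_pos (hIT b (Finset.mem_range.1 hb) (Finset.mem_union_right _ hg))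
          (hJ b g hg).2.1 (hJ b g hg).2.2, hJcard]
        exact gapHit_le_one _ _ _
  have hn := hx.layerRank_edgeFinset_add_one hy
  have hTrank := layerRank_le_edgeRank hx.lev_lt T
  refine ⟨T, isSpanningTree_of_rank (fun e he => SimpleGraph.mem_edgeFinset.1 (hTE he))
    (by omega) (by omega), fun b hb hbN => ?_, fun t => ?_⟩
  · rw [← hx.gapHit_edgeFinset hy hb hbN, ← hJcard]
    congr 1
    ext e
    rw [Finset.mem_inter, mem_cut_levelsIn]
    constructor
    · rintro ⟨he, -, h1, h2⟩
      obtain ⟨b', _, hb'⟩ := Finset.mem_biUnion.1 he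
      rcases Finset.mem_union.1 hb' with h | h
      · have := hI b' e h
        omega
      · have := hJ b' e h
        obtain rfl : b' = b := by omega
        exact h
    · intro he
      have := hJ b e he
      exact ⟨hIT b hbN (Finset.mem_union_right _ he), this.1, by omega, by omega⟩
  · rw [hcardP]
    refine Finset.sum_le_sum fun b _ => Nat.add_le_add ?_ (hJgreedy b t)
    rw [Finset.filter_inter]
    convert hIgreedy b t using 2

/-! ### Splitting off Gao-trees -/

theorem IsSpanningTree.sum_chi_filter {G : SimpleGraph V} {T : Finset (Sym2 V)}
    (hT : IsSpanningTree G T) (P : Sym2 V → Prop) :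
    ∑ e ∈ G.edgeFinset.filter P, chi T e = (T.filter P).card := by
  rw [sum_chi]
  congr 2
  ext e
  simp only [Finset.mem_inter, Finset.mem_filter, SimpleGraph.mem_edgeFinset]
  exact ⟨fun h => ⟨h.1, h.2.2⟩, fun h => ⟨h.1, hT.1 h.1, h.2⟩⟩

theorem finite_setOf_chi (P : Finset (Sym2 V) → Prop) :
    {z : Sym2 V → ℝ | ∃ T, P T ∧ z = chi T}.Finite := by
  refine (Set.finite_range (chi (V := V))).subset ?_
  rintro _ ⟨T, _, rfl⟩
  exact ⟨T, rfl⟩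

open scoped Pointwise in
theorem exists_split {A B : Set (Sym2 V → ℝ)} (hA : A.Finite) (hB : B.Finite) {lam : ℝ}
    {y : Sym2 V → ℝ}
    (h : ∀ c : Sym2 V → ℝ, ∃ a ∈ A, ∃ b ∈ B,
      ∑ e, c e * y e ≤ ∑ e, c e * (lam * a e + (1 - lam) * b e)) :
    ∃ a ∈ convexHull ℝ A, ∃ b ∈ convexHull ℝ B, y = lam • a + (1 - lam) • b := by
  by_contra! hcon
  have hK : IsCompact (lam • convexHull ℝ A + (1 - lam) • convexHull ℝ B) :=
    ((hA.isCompact_convexHull ℝ).smul lam).add ((hB.isCompact_convexHull ℝ).smul (1 - lam))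
  have hconv : Convex ℝ (lam • convexHull ℝ A + (1 - lam) • convexHull ℝ B) :=
    ((convex_convexHull ℝ A).smul lam).add ((convex_convexHull ℝ B).smul (1 - lam))
  have hy : y ∉ lam • convexHull ℝ A + (1 - lam) • convexHull ℝ B := by
    rintro ⟨_, ⟨a, ha, rfl⟩, _, ⟨b, hb, rfl⟩, h⟩
    exact hcon a ha b hb h.symm
  obtain ⟨f, u, h1, h2⟩ := geometric_hahn_banach_closed_point hconv hK.isClosed hy
  obtain ⟨a, ha, b, hb, hab⟩ := h fun e => f fun j => if e = j then 1 else 0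
  have hf : ∀ z : Sym2 V → ℝ, f z = ∑ e, (f fun j => if e = j then 1 else 0) * z e := by
    intro z
    have := LinearMap.pi_apply_eq_sum_univ f.toLinearMap z
    simp only [smul_eq_mul, ContinuousLinearMap.coe_coe] at this
    rw [this]
    exact Finset.sum_congr rfl fun e _ => mul_comm _ _
  have h3 := h1 (lam • a + (1 - lam) • b) (Set.add_mem_add
    (Set.smul_mem_smul_set (subset_convexHull ℝ A ha))
    (Set.smul_mem_smul_set (subset_convexHull ℝ B hb)))
  rw [hf] at h3 h2
  simp only [Pi.add_apply, Pi.smul_apply, smul_eq_mul] at h3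
  linarith

theorem LayeredPoint.exists_split [Nonempty V] {G : SimpleGraph V} {lev : V → ℕ} {N : ℕ}
    {lam : ℝ} {y : Sym2 V → ℝ} (hx : LayeredPoint lev N lam y) (hy : TreePoint G y) :
    ∃ a ∈ convexHull ℝ {z : Sym2 V → ℝ | ∃ T, (IsSpanningTree G T ∧
        ∀ b, 0 < b → b < N → (T ∩ cut G (levelsIn lev 0 b)).card = 1) ∧ z = chi T},
      ∃ b ∈ spanningTreePolytope G, y = lam • a + (1 - lam) • b := by
  refine _root_.exists_split (finite_setOf_chi _) (finite_setOf_chi _) fun c => ?_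
  obtain ⟨T₁, hT₁, hcut, hg₁⟩ := hx.exists_greedy_gaoTree hy c
  obtain ⟨T₂, hT₂, hg₂⟩ := hy.exists_greedy_tree c
  refine ⟨_, ⟨T₁, ⟨hT₁, hcut⟩, rfl⟩, _, ⟨T₂, hT₂, rfl⟩, ?_⟩
  have hl := hx.lam_pos
  have hl1 := hx.lam_le_one
  have key := sum_mul_nonneg_of_threshold c
    (fun e => lam * chi T₁ e + (1 - lam) * chi T₂ e - y e) G.edgeFinset ?_ ?_
  · have h0 : ∑ e ∈ G.edgeFinset, c e * (lam * chi T₁ e + (1 - lam) * chi T₂ e - y e) =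
        ∑ e, c e * (lam * chi T₁ e + (1 - lam) * chi T₂ e - y e) := by
      refine Finset.sum_subset (Finset.subset_univ _) fun e _ he => ?_
      have h : ∀ T, IsSpanningTree G T → chi T e = 0 := fun T hT =>
        if_neg fun h => he (SimpleGraph.mem_edgeFinset.2 (hT.1 h))
      rw [hy.eq_zero e he, h _ hT₁, h _ hT₂]
      ring
    rw [h0] at key
    simp only [mul_sub, Finset.sum_sub_distrib] at key
    linarith
  · have h1 := hT₁.sum_chi_filter fun _ => True
    have h2 := hT₂.sum_chi_filter fun _ => True
    simp only [Finset.filter_true] at h1 h2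
    have h3 : (T₁.card : ℝ) + 1 = Fintype.card V := by exact_mod_cast hT₁.card_add_one
    have h4 : (T₂.card : ℝ) + 1 = Fintype.card V := by exact_mod_cast hT₂.card_add_one
    rw [Finset.sum_sub_distrib, Finset.sum_add_distrib, ← Finset.mul_sum, ← Finset.mul_sum,
      h1, h2, hy.sum_edgeFinset, ← h3, eq_sub_of_add_eq h4, ← h3]
    ring
  · intro t
    rw [Finset.sum_sub_distrib, Finset.sum_add_distrib, ← Finset.mul_sum, ← Finset.mul_sum,
      hT₁.sum_chi_filter, hT₂.sum_chi_filter]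
    have h1 : (layerRank lev N (G.edgeFinset.filter fun e => t ≤ c e) : ℝ) ≤
        ((T₁.filter fun e => t ≤ c e).card : ℝ) := by exact_mod_cast hg₁ t
    have h2 : (edgeRank (G.edgeFinset.filter fun e => t ≤ c e) : ℝ) ≤
        ((T₂.filter fun e => t ≤ c e).card : ℝ) := by exact_mod_cast hg₂ t
    have h3 := hx.sum_le (G.edgeFinset.filter fun e => t ≤ c e)
    have h4 := mul_le_mul_of_nonneg_left h1 hl.le
    have h5 := mul_le_mul_of_nonneg_left h2 (sub_nonneg.2 hl1)
    linarith

/-! ### Chains -/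

theorem chain_ssubset {Vc : ℕ → Finset V} {k : ℕ} (hchain : ∀ i < k, Vc i ⊂ Vc (i + 1))
    {i j : ℕ} (hij : i < j) (hj : j ≤ k) : Vc i ⊂ Vc j := by
  induction j, hij using Nat.le_induction with
  | base => exact hchain i (by omega)
  | succ j _ ih => exact (ih (by omega)).trans (hchain j (by omega))

theorem chain_subset {Vc : ℕ → Finset V} {k : ℕ} (hchain : ∀ i < k, Vc i ⊂ Vc (i + 1))
    {i j : ℕ} (hij : i ≤ j) (hj : j ≤ k) : Vc i ⊆ Vc j := by
  rcases hij.eq_or_lt with rfl | h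
  · exact subset_rfl
  · exact (chain_ssubset hchain h hj).subset

theorem exists_card_filter_le_eq {I : Finset ℕ} {b : ℕ} (hb : 0 < b) (hbI : b ≤ I.card) :
    ∃ i ∈ I, (I.filter fun i' => i' ≤ i).card = b := by
  have hlt : ∀ i ∈ I, ∀ j ∈ I, i < j →
      (I.filter fun i' => i' ≤ i).card < (I.filter fun i' => i' ≤ j).card := by
    intro i _ j hj hij
    refine Finset.card_lt_card (Finset.ssubset_iff_of_subset ?_ |>.2 ⟨j, ?_, ?_⟩)
    · intro a ha
      rw [Finset.mem_filter] at ha ⊢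
      exact ⟨ha.1, by omega⟩
    · simp [hj]
    · simp [hij]
  have hinj : Set.InjOn (fun i => (I.filter fun i' => i' ≤ i).card) (I : Set ℕ) := by
    intro i hi j hj h
    rcases lt_trichotomy i j with h1 | h1 | h1
    · exact absurd h (hlt i hi j hj h1).ne
    · exact h1
    · exact absurd h (hlt j hj i hi h1).ne'
  have hsub : I.image (fun i => (I.filter fun i' => i' ≤ i).card) ⊆ Finset.Icc 1 I.card := by
    intro r hr
    obtain ⟨i, hi, rfl⟩ := Finset.mem_image.1 hr
    rw [Finset.mem_Icc]
    exact ⟨Finset.card_pos.2 ⟨i, by simp [hi]⟩, Finset.card_le_card (Finset.filter_subset _ _)⟩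
  have heq := Finset.eq_of_subset_of_card_le hsub (by
    rw [Finset.card_image_of_injOn hinj, Nat.card_Icc]
    omega)
  have : b ∈ I.image (fun i => (I.filter fun i' => i' ≤ i).card) := by
    rw [heq, Finset.mem_Icc]
    omega
  simpa using this

theorem exists_levels [Nonempty V] {Vc : ℕ → Finset V} {k : ℕ} (hne : (Vc 0).Nonempty)
    (hchain : ∀ i < k, Vc i ⊂ Vc (i + 1)) (htop : Vc k ⊂ Finset.univ) {I : Finset ℕ}
    (hI : ∀ i ∈ I, i ≤ k) :
    ∃ (lev : V → ℕ) (N : ℕ), (∀ v, lev v < N) ∧ (∀ b < N, ∃ v, lev v = b) ∧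
      (∀ b, 0 < b → b < N → ∃ i ∈ I, levelsIn lev 0 b = Vc i) ∧
      ∀ i ∈ I, ∃ b, 0 < b ∧ b < N ∧ levelsIn lev 0 b = Vc i := by
  set lev : V → ℕ := fun v => (I.filter fun i => v ∉ Vc i).card with hlev
  have hle : ∀ v, lev v ≤ I.card := fun v => Finset.card_le_card (Finset.filter_subset _ _)
  have key : ∀ i ∈ I, ∀ v, lev v < (I.filter fun i' => i' ≤ i).card ↔ v ∈ Vc i := by
    intro i hi v
    constructor
    · contrapose!
      intro hv
      refine Finset.card_le_card fun i' hi' => ?_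
      rw [Finset.mem_filter] at hi' ⊢
      exact ⟨hi'.1, fun h => hv (chain_subset hchain hi'.2 (hI i hi) h)⟩
    · intro hv
      refine Finset.card_lt_card (Finset.ssubset_iff_of_subset (fun i' hi' => ?_) |>.2 ⟨i, ?_, ?_⟩)
      · rw [Finset.mem_filter] at hi' ⊢
        refine ⟨hi'.1, ?_⟩
        by_contra h
        exact hi'.2 (chain_subset hchain (not_le.1 h).le (hI i' hi'.1) hv)
      · simp [hi]
      · simp [hv]
  have key' : ∀ i ∈ I, levelsIn lev 0 (I.filter fun i' => i' ≤ i).card = Vc i := by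
    intro i hi
    ext v
    rw [mem_levelsIn, ← key i hi]
    simp
  refine ⟨lev, I.card + 1, fun v => Nat.lt_succ_of_le (hle v), fun b hb => ?_,
    fun b hb hbN => ?_, fun i hi => ⟨_, ?_, ?_, key' i hi⟩⟩
  · have hup : ∀ W : Finset V, W ⊂ Finset.univ → (∀ v, v ∉ W → b ≤ lev v) →
        (∀ i ∈ I, b + 1 = (I.filter fun i' => i' ≤ i).card → W ⊂ Vc i) → ∃ v, lev v = b := by
      intro W hW hWlev hWV
      rcases (Nat.le_of_lt_succ hb).eq_or_lt with rfl | hb'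
      · obtain ⟨v, _, hv⟩ := Finset.exists_of_ssubset hW
        exact ⟨v, le_antisymm (hle v) (hWlev v hv)⟩
      · obtain ⟨j, hj, hjb⟩ := exists_card_filter_le_eq (I := I) (Nat.succ_pos b) hb'
        obtain ⟨v, hv, hv'⟩ := Finset.exists_of_ssubset (hWV j hj hjb.symm)
        have h1 := (key j hj v).2 hv
        have h2 := hWlev v hv'
        exact ⟨v, by omega⟩
    rcases Nat.eq_zero_or_pos b with rfl | hb0
    · refine hup ∅ ?_ (fun v _ => Nat.zero_le _) fun i hi _ => ?_
      · exact Finset.empty_ssubset.2 Finset.univ_nonempty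
      · exact Finset.empty_ssubset.2 (hne.mono (chain_subset hchain (Nat.zero_le i) (hI i hi)))
    · obtain ⟨i, hi, rfl⟩ := exists_card_filter_le_eq (I := I) hb0 (by omega)
      refine hup (Vc i) ?_ (fun v hv => ?_) fun j hj hjb => ?_
      · exact (chain_subset hchain (hI i hi) le_rfl).trans_ssubset htop
      · by_contra h
        exact hv ((key i hi v).1 (not_le.1 h))
      · refine chain_ssubset hchain ?_ (hI j hj)
        by_contra h
        have : (I.filter fun i' => i' ≤ j).card ≤ (I.filter fun i' => i' ≤ i).card :=
          Finset.card_le_card fun a ha => by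
            rw [Finset.mem_filter] at ha ⊢
            exact ⟨ha.1, by omega⟩
        omega
  · obtain ⟨i, hi, rfl⟩ := exists_card_filter_le_eq (I := I) hb (by omega)
    exact ⟨i, hi, key' i hi⟩
  · exact Finset.card_pos.2 ⟨i, by simp [hi]⟩
  · exact Nat.lt_succ_of_le (Finset.card_le_card (Finset.filter_subset _ _))

/-- The convex hull of the Gao-trees for the subchain with index set `I`. -/
noncomputable def gaoPolytopeOn (G : SimpleGraph V) (Vc : ℕ → Finset V) (I : Finset ℕ) :
    Set (Sym2 V → ℝ) :=
  convexHull ℝ {z : Sym2 V → ℝ | ∃ T : Finset (Sym2 V), IsGaoTreeOn G Vc I T ∧ z = chi T}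

theorem exists_split_chain [Nonempty V] {G : SimpleGraph V} {Vc : ℕ → Finset V} {k : ℕ}
    (hne : (Vc 0).Nonempty) (hchain : ∀ i < k, Vc i ⊂ Vc (i + 1)) (htop : Vc k ⊂ Finset.univ)
    {I : Finset ℕ} (hI : ∀ i ∈ I, i ≤ k) {lam : ℝ} (hlam : 0 < lam) (hlam1 : lam ≤ 1)
    {y : Sym2 V → ℝ} (hy : y ∈ spanningTreePolytope G)
    (hcut : ∀ i ∈ I, ∑ e ∈ cut G (Vc i), y e ≤ 2 - lam)
    (hdeg : ∀ i ∈ I, degSum G (Vc i) y = 2 * ((Vc i).card : ℝ) - 1) :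
    ∃ a ∈ gaoPolytopeOn G Vc I, ∃ b ∈ spanningTreePolytope G, y = lam • a + (1 - lam) • b := by
  obtain ⟨lev, N, h1, h2, h3, h4⟩ := exists_levels hne hchain htop hI
  have hty := treePoint_of_mem hy
  have hx : LayeredPoint lev N lam y := by
    refine hty.layeredPoint h1 h2 hlam hlam1 (fun b hb hbN => ?_) (fun b hb hbN => ?_)
    · obtain ⟨i, hi, hib⟩ := h3 b hb hbN
      rw [hib]
      exact hcut i hi
    · obtain ⟨i, hi, hib⟩ := h3 b hb hbN
      rw [hib]
      exact hdeg i hi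
  obtain ⟨a, ha, b, hb, hab⟩ := hx.exists_split hty
  refine ⟨a, convexHull_mono ?_ ha, b, hb, hab⟩
  rintro _ ⟨T, ⟨hT, hTcut⟩, rfl⟩
  refine ⟨T, ⟨hT, fun i hi => ?_⟩, rfl⟩
  obtain ⟨c, hc, hcN, hci⟩ := h4 i hi
  rw [← hci]
  exact hTcut c hc hcN

/-- Summation over a set of edges, as a linear functional. -/
noncomputable def sumOn (F : Finset (Sym2 V)) : (Sym2 V → ℝ) →ₗ[ℝ] ℝ :=
  ∑ e ∈ F, LinearMap.proj (R := ℝ) (φ := fun _ : Sym2 V => ℝ) e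

theorem sumOn_apply (F : Finset (Sym2 V)) (y : Sym2 V → ℝ) : sumOn F y = ∑ e ∈ F, y e := by
  simp [sumOn]

theorem sum_cut_eq_one_of_mem_gaoPolytopeOn {G : SimpleGraph V} {Vc : ℕ → Finset V}
    {I : Finset ℕ} {a : Sym2 V → ℝ} (ha : a ∈ gaoPolytopeOn G Vc I) {i : ℕ} (hi : i ∈ I) :
    ∑ e ∈ cut G (Vc i), a e = 1 := by
  rw [← sumOn_apply]
  have hconv : Convex ℝ {a | sumOn (cut G (Vc i)) a = 1} :=
    (convex_singleton (1 : ℝ)).linear_preimage _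
  refine convexHull_min ?_ hconv ha
  rintro _ ⟨T, hT, rfl⟩
  change sumOn _ _ = 1
  rw [sumOn_apply, sum_chi, hT.2 i hi, Nat.cast_one]

theorem gaoPolytopeOn_subset (G : SimpleGraph V) (Vc : ℕ → Finset V) (I : Finset ℕ) :
    gaoPolytopeOn G Vc I ⊆ spanningTreePolytope G := by
  refine convexHull_mono ?_
  rintro _ ⟨T, hT, rfl⟩
  exact ⟨T, hT.1, rfl⟩

theorem degSum_eq_of_mem_of_cut_eq_one {G : SimpleGraph V} {Vc : ℕ → Finset V} {k : ℕ}
    (hne : (Vc 0).Nonempty) (hchain : ∀ i < k, Vc i ⊂ Vc (i + 1)) (htop : Vc k ⊂ Finset.univ)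
    {y : Sym2 V → ℝ} (hy : y ∈ spanningTreePolytope G) {i : ℕ} (hi : i ≤ k)
    (hcut : ∑ e ∈ cut G (Vc i), y e = 1) : degSum G (Vc i) y = 2 * ((Vc i).card : ℝ) - 1 := by
  refine (treePoint_of_mem hy).degSum_eq_of_cut_eq_one
    (hne.mono (chain_subset hchain (Nat.zero_le i) hi)) ?_ hcut
  obtain ⟨v, _, hv⟩ := Finset.exists_of_ssubset htop
  exact ⟨v, Finset.mem_compl.2 fun h => hv (chain_subset hchain hi le_rfl h)⟩

theorem IsChainPoint.degSum_eq {G : SimpleGraph V} {Vc : ℕ → Finset V} {k : ℕ}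
    (hne : (Vc 0).Nonempty) (hchain : ∀ i < k, Vc i ⊂ Vc (i + 1)) (htop : Vc k ⊂ Finset.univ)
    {x : Sym2 V → ℝ} (hx : IsChainPoint G Vc k x) {i : ℕ} (hi : i ≤ k) :
    degSum G (Vc i) x = 2 * ((Vc i).card : ℝ) - 1 := by
  induction i with
  | zero => exact degSum_eq_of_mem_of_cut_eq_one hne hchain htop hx.1 hi hx.2.1
  | succ i ih =>
    have h1 : level Vc k (i + 1) = Vc (i + 1) \ Vc i := by
      simp [level, hi]
    have h2 := hx.2.2.2.2 (i + 1) (by omega) hi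
    rw [h1] at h2
    have h3 := degSum_union G (Finset.disjoint_sdiff (s := Vc i) (t := Vc (i + 1))) x
    rw [Finset.union_sdiff_of_subset (hchain i hi).subset, ih (by omega)] at h3
    have h4 : ((Vc (i + 1) \ Vc i).card : ℝ) + (Vc i).card = (Vc (i + 1)).card := by
      exact_mod_cast Finset.card_sdiff_add_card_eq_card (hchain i hi).subset
    unfold degSum at h3 ⊢
    linarith

theorem stmt2 (G : SimpleGraph V) (hG : G.Connected)
    (Vc : ℕ → Finset V) (k : ℕ)
    (hne : (Vc 0).Nonempty) (hchain : ∀ i < k, Vc i ⊂ Vc (i + 1))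
    (htop : Vc k ⊂ Finset.univ)
    (x : Sym2 V → ℝ) (hx : IsChainPoint G Vc k x)
    (ℓ : ℕ) (hℓ : 1 ≤ ℓ) (lam : ℕ → ℝ)
    (hpos : ∀ j, 1 ≤ j → j ≤ ℓ → 0 < lam j)
    (hvals : ∀ i ≤ k, ∃ h, 1 ≤ h ∧ h ≤ ℓ ∧
      (∑ e ∈ cut G (Vc i), x e) = 2 - ∑ j ∈ Finset.Icc 1 h, lam j)
    (hallvals : ∀ h, 1 ≤ h → h ≤ ℓ → ∃ i ≤ k,
      (∑ e ∈ cut G (Vc i), x e) = 2 - ∑ j ∈ Finset.Icc 1 h, lam j)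
    (hsum : ∑ j ∈ Finset.Icc 1 ℓ, lam j = 1) :
    ∃ xs : ℕ → (Sym2 V → ℝ),
      (x = fun e => ∑ j ∈ Finset.Icc 1 ℓ, lam j * xs j e) ∧
      ∀ j, 1 ≤ j → j ≤ ℓ →
        xs j ∈ convexHull ℝ {z : Sym2 V → ℝ | ∃ T : Finset (Sym2 V),
          IsGaoTreeOn G Vc
            ((Finset.range (k + 1)).filter (fun i =>
              (∑ e ∈ cut G (Vc i), x e) ≤ 2 - ∑ j' ∈ Finset.Icc 1 j, lam j')) T ∧
          z = chi T} := by
  have : Nonempty V := hG.nonempty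
  set S : ℕ → ℝ := fun h => ∑ j ∈ Finset.Icc 1 h, lam j with hS
  have hSsucc : ∀ h, S (h + 1) = S h + lam (h + 1) := fun h =>
    Finset.sum_Icc_succ_top (Nat.le_add_left 1 h) lam
  have hSmono : ∀ h h', h ≤ h' → h' ≤ ℓ → S h ≤ S h' := by
    intro h h' hh hh'
    refine Finset.sum_le_sum_of_subset_of_nonneg (Finset.Icc_subset_Icc_right hh) fun j hj _ => ?_
    rw [Finset.mem_Icc] at hj
    exact (hpos j hj.1 (hj.2.trans hh')).le
  set I : ℕ → Finset ℕ := fun j => (Finset.range (k + 1)).filter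
    (fun i => (∑ e ∈ cut G (Vc i), x e) ≤ 2 - S j) with hI
  have hIk : ∀ j, ∀ i ∈ I j, i ≤ k := fun j i hi =>
    Nat.le_of_lt_succ (Finset.mem_range.1 (Finset.mem_filter.1 hi).1)
  have main : ∀ h ≤ ℓ, ∃ (xs : ℕ → Sym2 V → ℝ) (y : Sym2 V → ℝ),
      x = ∑ j ∈ Finset.Icc 1 h, lam j • xs j + (1 - S h) • y ∧ y ∈ spanningTreePolytope G ∧
      ∀ j, 1 ≤ j → j ≤ h → xs j ∈ gaoPolytopeOn G Vc (I j) := by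
    intro h
    induction h with
    | zero => exact fun _ => ⟨0, x, by simp [hS], hx.1, fun j h1 h2 => by omega⟩
    | succ h ih =>
      intro hh
      obtain ⟨xs, y, hxy, hy, hxs⟩ := ih (by omega)
      have hl := hpos (h + 1) (by omega) hh
      have hS1 : S (h + 1) ≤ 1 := hsum ▸ hSmono (h + 1) ℓ hh le_rfl
      rw [hSsucc] at hS1
      have hd : 0 < 1 - S h := by linarith
      have hlin : ∀ (g : (Sym2 V → ℝ) →ₗ[ℝ] ℝ) (γ : ℝ), (∀ j, 1 ≤ j → j ≤ h → g (xs j) = γ) →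
          g x = S h * γ + (1 - S h) * g y := by
        intro g γ hg
        rw [hxy, map_add, map_sum, map_smul, smul_eq_mul, hS, Finset.sum_mul]
        congr 1
        refine Finset.sum_congr rfl fun j hj => ?_
        rw [Finset.mem_Icc] at hj
        rw [map_smul, smul_eq_mul, hg j hj.1 hj.2]
      have hcut1 : ∀ i ∈ I (h + 1), ∀ j, 1 ≤ j → j ≤ h → ∑ e ∈ cut G (Vc i), xs j e = 1 := by
        intro i hi j hj1 hj
        refine sum_cut_eq_one_of_mem_gaoPolytopeOn (hxs j hj1 hj) ?_
        rw [Finset.mem_filter] at hi ⊢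
        refine ⟨hi.1, hi.2.trans ?_⟩
        have := hSmono j (h + 1) (by omega) hh
        linarith
      obtain ⟨a, ha, b, hb, hab⟩ := exists_split_chain hne hchain htop (hIk (h + 1))
        (lam := lam (h + 1) / (1 - S h)) (div_pos hl hd) ((div_le_one hd).2 (by linarith)) hy
        (fun i hi => by
          have h1 := hlin (sumOn (cut G (Vc i))) 1 fun j hj1 hj => by
            rw [sumOn_apply]; exact hcut1 i hi j hj1 hj
          rw [sumOn_apply, sumOn_apply] at h1
          have h2 := (Finset.mem_filter.1 hi).2
          rw [hSsucc] at h2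
          rw [le_sub_iff_add_le, ← le_sub_iff_add_le', div_le_iff₀ hd]
          linarith)
        (fun i hi => by
          have h0 : ∀ z, degSum G (Vc i) z = (∑ v ∈ Vc i, sumOn (cut G {v})) z := by
            intro z
            simp [degSum, sumOn_apply]
          have h1 := hlin (∑ v ∈ Vc i, sumOn (cut G {v})) (2 * ((Vc i).card : ℝ) - 1)
            fun j hj1 hj => by
              rw [← h0]
              exact degSum_eq_of_mem_of_cut_eq_one hne hchain htop
                (gaoPolytopeOn_subset _ _ _ (hxs j hj1 hj)) (hIk _ i hi) (hcut1 i hi j hj1 hj)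
          rw [← h0, ← h0, hx.degSum_eq hne hchain htop (hIk _ i hi)] at h1
          refine mul_left_cancel₀ hd.ne' ?_
          linarith)
      refine ⟨Function.update xs (h + 1) a, b, ?_, hb, fun j hj1 hj => ?_⟩
      · rw [Finset.sum_Icc_succ_top (Nat.le_add_left 1 h), Function.update_self, hSsucc]
        have h1 : ∑ j ∈ Finset.Icc 1 h, lam j • Function.update xs (h + 1) a j =
            ∑ j ∈ Finset.Icc 1 h, lam j • xs j := by
          refine Finset.sum_congr rfl fun j hj => ?_
          rw [Finset.mem_Icc] at hj
          rw [Function.update_of_ne (by omega)]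
        rw [h1, add_assoc]
        conv_lhs => rw [hxy, hab, smul_add, smul_smul, smul_smul]
        congr 3
        · field_simp
        · field_simp
          ring
      · rcases hj.eq_or_lt with rfl | hj
        · rwa [Function.update_self]
        · rw [Function.update_of_ne (by omega)]
          exact hxs j hj1 (by omega)
  obtain ⟨xs, y, hxy, -, hxs⟩ := main ℓ le_rfl
  refine ⟨xs, ?_, hxs⟩
  have h1 : 1 - S ℓ = 0 := by rw [hS]; simp only [hsum, sub_self]
  rw [h1, zero_smul, add_zero] at hxy
  rw [hxy]
  ext e
  simp
end

section
/- Let x be a chain-point for the chain V_0 ⊊ V_1 ⊊ … ⊊ V_k and let U ⊆ V satisfy x(E(U)) = |U| − 1. Then there exists a Gao-tree T of G such that T ∩ E(U) is the edge set of a spanning tree of the induced subgraph G(U). (Equivalently, the rank of E(U) in the matroid whose bases are the Gao-trees equals its rank |U| − 1 in the cycle matroid of G.) -/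
open Finset
open scoped Classical

variable {V : Type*} [Fintype V]

theorem mem_inducedEdges_mk {G : SimpleGraph V} {S : Finset V} {a b : V} :
    s(a, b) ∈ inducedEdges G S ↔ G.Adj a b ∧ a ∈ S ∧ b ∈ S := by
  simp [inducedEdges]

theorem mem_cut_mk {G : SimpleGraph V} {S : Finset V} {a b : V} :
    s(a, b) ∈ cut G S ↔ G.Adj a b ∧ (a ∈ S ∧ b ∉ S ∨ b ∈ S ∧ a ∉ S) := by
  simp only [cut, cutBetween, mem_filter, SimpleGraph.mem_edgeFinset, SimpleGraph.mem_edgeSet,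
    mem_compl, and_congr_right_iff, Sym2.eq_iff]
  intro _
  constructor
  · rintro ⟨u, v, ⟨rfl, rfl⟩ | ⟨rfl, rfl⟩, hu, hv⟩ <;> tauto
  · rintro (⟨h₁, h₂⟩ | ⟨h₁, h₂⟩)
    · exact ⟨a, b, by tauto⟩
    · exact ⟨b, a, by tauto⟩

theorem sum_inducedEdges (G : SimpleGraph V) (S : Finset V)
    (x : Sym2 V → ℝ) :
    ∑ e ∈ inducedEdges G S, x e =
      ∑ e ∈ G.edgeFinset, if e ∈ inducedEdges G S then x e else 0 := by
  rw [← sum_filter]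
  congr 1
  ext e
  simp +contextual [inducedEdges]

theorem sum_cut (G : SimpleGraph V) (S : Finset V)
    (x : Sym2 V → ℝ) :
    ∑ e ∈ cut G S, x e = ∑ e ∈ G.edgeFinset, if e ∈ cut G S then x e else 0 := by
  rw [← sum_filter]
  congr 1
  ext e
  simp +contextual [cut, cutBetween]

section WeightIdentities

variable {G : SimpleGraph V} {x : Sym2 V → ℝ}

theorem sum_inducedEdges_add_le (hx : ∀ e, 0 ≤ x e) (A B : Finset V) :
    ∑ e ∈ inducedEdges G A, x e + ∑ e ∈ inducedEdges G B, x e ≤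
      ∑ e ∈ inducedEdges G (A ∩ B), x e + ∑ e ∈ inducedEdges G (A ∪ B), x e := by
  simp only [sum_inducedEdges, ← sum_add_distrib]
  refine sum_le_sum fun e _ => ?_
  have := hx e
  induction e with | _ a b
  simp only [mem_inducedEdges_mk, mem_inter, mem_union]
  split_ifs <;> first | linarith | tauto

theorem sum_inducedEdges_add_compl_add_cut (S : Finset V) :
    ∑ e ∈ inducedEdges G S, x e + ∑ e ∈ inducedEdges G Sᶜ, x e + ∑ e ∈ cut G S, x e =
      ∑ e ∈ G.edgeFinset, x e := by
  simp only [sum_inducedEdges, sum_cut, ← sum_add_distrib]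
  refine sum_congr rfl fun e he => ?_
  induction e with | _ a b
  have he' : G.Adj a b := by simpa using he
  simp only [mem_inducedEdges_mk, mem_cut_mk, mem_compl, he', true_and]
  split_ifs <;> first | linarith | tauto

theorem sum_sum_cut_singleton (S : Finset V) :
    ∑ v ∈ S, ∑ e ∈ cut G {v}, x e =
      2 * ∑ e ∈ inducedEdges G S, x e + ∑ e ∈ cut G S, x e := by
  simp only [sum_inducedEdges, sum_cut, mul_sum]
  rw [sum_comm, ← sum_add_distrib]
  refine sum_congr rfl fun e he => ?_
  induction e with | _ a b
  have he' : G.Adj a b := by simpa using he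
  have hab : a ≠ b := he'.ne
  have key : ∀ v, (if s(a, b) ∈ cut G {v} then x s(a, b) else 0) =
      (if a = v then x s(a, b) else 0) + (if b = v then x s(a, b) else 0) := by
    intro v
    simp only [mem_cut_mk, mem_singleton, he', true_and]
    by_cases h₁ : a = v <;> by_cases h₂ : b = v <;> simp_all
  rw [sum_congr rfl fun v _ => key v]
  simp only [sum_add_distrib, sum_ite_eq, mem_inducedEdges_mk, mem_cut_mk, he', true_and]
  by_cases h₁ : a ∈ S <;> by_cases h₂ : b ∈ S <;> (simp [h₁, h₂]; try ring)

theorem sum_cut_sdiff_le (hx : ∀ e, 0 ≤ x e) (A B : Finset V) :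
    ∑ e ∈ cut G (B \ A), x e ≤ ∑ e ∈ cut G A, x e + ∑ e ∈ cut G B, x e := by
  simp only [sum_cut, ← sum_add_distrib]
  refine sum_le_sum fun e _ => ?_
  have := hx e
  induction e with | _ a b
  simp only [mem_cut_mk, mem_sdiff]
  split_ifs <;> first | linarith | tauto

theorem sum_inducedEdges_union_of_not_adj {P Q : Finset V} (hPQ : Disjoint P Q)
    (h : ∀ p ∈ P, ∀ q ∈ Q, ¬ G.Adj p q) :
    ∑ e ∈ inducedEdges G (P ∪ Q), x e =
      ∑ e ∈ inducedEdges G P, x e + ∑ e ∈ inducedEdges G Q, x e := by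
  simp only [sum_inducedEdges, ← sum_add_distrib]
  refine sum_congr rfl fun e he => ?_
  induction e with | _ a b
  have he' : G.Adj a b := by simpa using he
  have h₁ : a ∈ P → b ∉ Q := fun ha hb => h a ha b hb he'
  have h₂ : b ∈ P → a ∉ Q := fun hb ha => h b hb a ha he'.symm
  have h₃ : a ∈ P → a ∉ Q := fun ha hb => disjoint_left.1 hPQ ha hb
  simp only [mem_inducedEdges_mk, mem_union, he', true_and]
  split_ifs <;> first | linarith | tauto

theorem sum_cut_sdiff_add_le (hx : ∀ e, 0 ≤ x e) {A B U : Finset V} (hAB : A ⊆ B)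
    (hU : Disjoint U (B \ A)) :
    ∑ e ∈ cut G (B \ A), x e + 2 * ∑ e ∈ inducedEdges G U, x e ≤
      ∑ e ∈ cut G A, x e + ∑ e ∈ cut G B, x e +
        2 * ∑ e ∈ inducedEdges G (U ∩ A), x e + 2 * ∑ e ∈ inducedEdges G (U \ A), x e := by
  simp only [sum_inducedEdges, sum_cut, mul_sum, ← sum_add_distrib]
  refine sum_le_sum fun e he => ?_
  have := hx e
  induction e with | _ a b
  have he' : G.Adj a b := by simpa using he
  have hA : ∀ v, v ∈ A → v ∈ B := fun v hv => hAB hv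
  have hD : ∀ v, v ∈ U → v ∈ B → v ∈ A := fun v h₁ h₂ => by
    by_contra h₃
    exact disjoint_left.1 hU h₁ (mem_sdiff.2 ⟨h₂, h₃⟩)
  have := hA a
  have := hA b
  have := hD a
  have := hD b
  simp only [mem_inducedEdges_mk, mem_cut_mk, mem_inter, mem_sdiff, he', true_and]
  clear hA hD hAB hU he
  by_cases a ∈ A <;> by_cases b ∈ A <;> by_cases a ∈ B <;> by_cases b ∈ B <;>
    by_cases a ∈ U <;> by_cases b ∈ U <;> simp_all <;> linarith

end WeightIdentities

section Forests

theorem SimpleGraph.IsAcyclic.card_edgeFinset_add_one_le [Nonempty V]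
    {F : SimpleGraph V} (hF : F.IsAcyclic) : F.edgeFinset.card + 1 ≤ Fintype.card V := by
  obtain ⟨T, hFT, -, hT⟩ :=
    (SimpleGraph.connected_top (V := V)).exists_isTree_le_of_le_of_isAcyclic le_top hF
  rw [← hT.card_edgeFinset]
  gcongr

theorem card_inducedEdges (F : SimpleGraph V) (S : Finset V) :
    (inducedEdges F S).card = (F.induce (S : Set V)).edgeFinset.card := by
  rw [← card_map (Function.Embedding.sym2Map (Function.Embedding.subtype (· ∈ (S : Set V))))]
  congr 1
  ext e
  induction e with | _ a b
  simp only [mem_inducedEdges_mk, mem_map, Sym2.exists]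
  constructor
  · rintro ⟨h, ha, hb⟩
    exact ⟨⟨a, ha⟩, ⟨b, hb⟩, by simpa using h, by simp⟩
  · rintro ⟨⟨a', ha⟩, ⟨b', hb⟩, h, h'⟩
    rw [SimpleGraph.mem_edgeFinset, SimpleGraph.mem_edgeSet] at h
    rw [← mem_inducedEdges_mk, ← h']
    exact mem_inducedEdges_mk.2 ⟨h, ha, hb⟩

theorem SimpleGraph.IsAcyclic.card_inducedEdges_add_one_le {F : SimpleGraph V} (hF : F.IsAcyclic)
    {S : Finset V} (hS : S.Nonempty) : (inducedEdges F S).card + 1 ≤ S.card := by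
  have : Nonempty (S : Set V) := hS.to_subtype
  rw [card_inducedEdges]
  convert (hF.induce (S : Set V)).card_edgeFinset_add_one_le
  simp

theorem IsSpanningTree.edgeSet_fromEdgeSet {W : Type*} {G : SimpleGraph W} {T : Finset (Sym2 W)}
    (hT : IsSpanningTree G T) : (SimpleGraph.fromEdgeSet (T : Set (Sym2 W))).edgeSet = T := by
  ext e
  rw [SimpleGraph.edgeSet_fromEdgeSet]
  exact ⟨fun h => h.1, fun h => ⟨h, G.not_isDiag_of_mem_edgeSet (hT.1 h)⟩⟩

theorem IsSpanningTree.card_inducedEdges_inter_add_one_le {G : SimpleGraph V} {T : Finset (Sym2 V)}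
    (hT : IsSpanningTree G T) {S : Finset V} (hS : S.Nonempty) :
    (inducedEdges G S ∩ T).card + 1 ≤ S.card := by
  refine le_trans (Nat.succ_le_succ (card_le_card ?_))
    (hT.2.isAcyclic.card_inducedEdges_add_one_le hS)
  intro e he
  rw [mem_inter, inducedEdges, mem_filter] at he
  rw [inducedEdges, mem_filter]
  refine ⟨?_, he.1.2⟩
  rw [← mem_coe, SimpleGraph.coe_edgeFinset, hT.edgeSet_fromEdgeSet]
  exact he.2

theorem spanningTreePolytope_bounds {G : SimpleGraph V} {x : Sym2 V → ℝ}
    (hx : x ∈ spanningTreePolytope G) :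
    (∀ e, 0 ≤ x e) ∧
    (∀ S : Finset V, S.Nonempty → ∑ e ∈ inducedEdges G S, x e ≤ (S.card : ℝ) - 1) ∧
    ∑ e ∈ G.edgeFinset, x e = (Fintype.card V : ℝ) - 1 := by
  suffices h : spanningTreePolytope G ⊆ {x | (∀ e, 0 ≤ x e) ∧
      (∀ S : Finset V, S.Nonempty → ∑ e ∈ inducedEdges G S, x e ≤ (S.card : ℝ) - 1) ∧
      ∑ e ∈ G.edgeFinset, x e = (Fintype.card V : ℝ) - 1} from h hx
  refine convexHull_min ?_ ?_
  · rintro _ ⟨T, hT, rfl⟩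
    refine ⟨fun e => ?_, fun S hS => ?_, ?_⟩
    · unfold chi
      split_ifs <;> norm_num
    · have := hT.card_inducedEdges_inter_add_one_le hS
      simp only [chi, sum_ite_mem, sum_const, nsmul_eq_mul, mul_one]
      rw [le_sub_iff_add_le]
      exact_mod_cast this
    · have hTG : G.edgeFinset ∩ T = T := by
        rw [inter_eq_right]
        intro e he
        exact SimpleGraph.mem_edgeFinset.2 (hT.1 he)
      simp only [chi, sum_ite_mem, sum_const, nsmul_eq_mul, mul_one, hTG]
      rw [eq_sub_iff_add_eq]
      exact_mod_cast hT.card_add_one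
  · intro y hy z hz a b ha hb hab
    refine ⟨fun e => ?_, fun S hS => ?_, ?_⟩
    · exact add_nonneg (mul_nonneg ha (hy.1 e)) (mul_nonneg hb (hz.1 e))
    · simp only [Pi.add_apply, Pi.smul_apply, smul_eq_mul, sum_add_distrib, ← mul_sum]
      nlinarith [mul_le_mul_of_nonneg_left (hy.2.1 S hS) ha,
        mul_le_mul_of_nonneg_left (hz.2.1 S hS) hb]
    · simp only [Pi.add_apply, Pi.smul_apply, smul_eq_mul, sum_add_distrib, ← mul_sum]
      rw [hy.2.2, hz.2.2, ← add_mul, hab, one_mul]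

end Forests

section Deficit

variable {G : SimpleGraph V} {x : Sym2 V → ℝ}

/-- The slack of `x` in the subtour constraint `x(E(S)) ≤ |S| - 1`. -/
noncomputable def deficit (G : SimpleGraph V) (x : Sym2 V → ℝ) (S : Finset V) : ℝ :=
  (S.card : ℝ) - 1 - ∑ e ∈ inducedEdges G S, x e

theorem deficit_nonneg (hx : x ∈ spanningTreePolytope G) {S : Finset V} (hS : S.Nonempty) :
    0 ≤ deficit G x S :=
  sub_nonneg.2 ((spanningTreePolytope_bounds hx).2.1 S hS)

theorem deficit_univ (hx : x ∈ spanningTreePolytope G) : deficit G x univ = 0 := by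
  have h : inducedEdges G univ = G.edgeFinset := by simp [inducedEdges]
  rw [deficit, h, (spanningTreePolytope_bounds hx).2.2, card_univ, sub_self]

theorem deficit_add_deficit_compl (hx : x ∈ spanningTreePolytope G) (S : Finset V) :
    deficit G x S + deficit G x Sᶜ + 1 = ∑ e ∈ cut G S, x e := by
  have h₁ := sum_inducedEdges_add_compl_add_cut (G := G) (x := x) S
  rw [(spanningTreePolytope_bounds hx).2.2] at h₁
  have h₂ : (S.card : ℝ) + (Sᶜ.card : ℝ) = Fintype.card V := by
    exact_mod_cast card_add_card_compl S
  unfold deficit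
  linarith

theorem deficit_inter_le (hx : x ∈ spanningTreePolytope G) {U S : Finset V}
    (hU : deficit G x U = 0) (hUS : (U ∩ S).Nonempty) :
    deficit G x (U ∩ S) ≤ deficit G x S := by
  have h₁ := sum_inducedEdges_add_le (G := G) (spanningTreePolytope_bounds hx).1 U S
  have h₂ := deficit_nonneg hx (hUS.mono (inter_subset_left.trans subset_union_left) :
    (U ∪ S).Nonempty)
  have h₃ : ((U ∪ S).card : ℝ) + ((U ∩ S).card : ℝ) = U.card + S.card := by
    exact_mod_cast card_union_add_card_inter U S
  unfold deficit at *
  linarith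

theorem exists_adj_of_deficit_lt_one (hx : x ∈ spanningTreePolytope G) {P Q : Finset V}
    (hP : P.Nonempty) (hQ : Q.Nonempty) (hPQ : Disjoint P Q) (h : deficit G x (P ∪ Q) < 1) :
    ∃ p ∈ P, ∃ q ∈ Q, G.Adj p q := by
  by_contra! hadj
  have h₁ := sum_inducedEdges_union_of_not_adj (x := x) hPQ hadj
  have h₂ := deficit_nonneg hx hP
  have h₃ := deficit_nonneg hx hQ
  have h₄ : ((P ∪ Q).card : ℝ) = P.card + Q.card := by
    exact_mod_cast card_union_of_disjoint hPQ
  unfold deficit at *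
  linarith

theorem two_mul_deficit_add_two {S : Finset V}
    (hS : ∑ v ∈ S, ∑ e ∈ cut G {v}, x e = 2 * (S.card : ℝ)) :
    2 * deficit G x S + 2 = ∑ e ∈ cut G S, x e := by
  rw [sum_sum_cut_singleton] at hS
  unfold deficit
  linarith

end Deficit

section Levels

/-- The vertices of level less than `j`. -/
def below (l : V → ℕ) (j : ℕ) : Finset V := univ.filter fun v => l v < j

theorem mem_below {l : V → ℕ} {j : ℕ} {v : V} : v ∈ below l j ↔ l v < j := by
  simp [below]

/-- `l` assigns levels `0, …, k + 1` such that the cuts between lower and higher levels have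
`x`-weight less than `2` and the inner levels have average degree `2`. -/
structure IsNarrowLevelling (G : SimpleGraph V) (x : Sym2 V → ℝ) (k : ℕ) (l : V → ℕ) : Prop where
  mem : x ∈ spanningTreePolytope G
  le : ∀ v, l v ≤ k + 1
  exists_eq : ∀ j ≤ k + 1, ∃ v, l v = j
  cut_lt : ∀ j, 1 ≤ j → j ≤ k + 1 → ∑ e ∈ cut G (below l j), x e < 2
  degree_eq : ∀ j, 1 ≤ j → j ≤ k →
    ∑ v ∈ below l (j + 1) \ below l j, ∑ e ∈ cut G {v}, x e =
      2 * ((below l (j + 1) \ below l j).card : ℝ)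

namespace IsNarrowLevelling

variable {G : SimpleGraph V} {x : Sym2 V → ℝ} {k : ℕ} {l : V → ℕ}

theorem degree_band_eq (h : IsNarrowLevelling G x k l) {i j : ℕ} (hi : 1 ≤ i) (hij : i ≤ j)
    (hj : j ≤ k + 1) :
    ∑ v ∈ below l j \ below l i, ∑ e ∈ cut G {v}, x e =
      2 * ((below l j \ below l i).card : ℝ) := by
  induction j, hij using Nat.le_induction with
  | base => simp
  | succ j hij ih =>
    have hsplit : below l (j + 1) \ below l i =
        (below l j \ below l i) ∪ (below l (j + 1) \ below l j) := by
      ext v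
      simp only [mem_union, mem_sdiff, mem_below]
      omega
    have hdisj : Disjoint (below l j \ below l i) (below l (j + 1) \ below l j) := by
      rw [disjoint_left]
      intro v
      simp only [mem_sdiff, mem_below]
      omega
    rw [hsplit, sum_union hdisj, card_union_of_disjoint hdisj, ih (by omega),
      h.degree_eq j (by omega) (by omega)]
    push_cast
    ring

theorem deficit_band_lt_one (h : IsNarrowLevelling G x k l) {i j : ℕ} (hij : i < j)
    (hj : j ≤ k + 2) : deficit G x (below l j \ below l i) < 1 := by
  have hlow : ∀ m, 1 ≤ m → (below l m).Nonempty := fun m hm => by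
    obtain ⟨v, hv⟩ := h.exists_eq 0 (by omega)
    exact ⟨v, mem_below.2 (by omega)⟩
  have hhigh : ∀ m ≤ k + 1, (below l m)ᶜ.Nonempty := fun m hm => by
    obtain ⟨v, hv⟩ := h.exists_eq (k + 1) le_rfl
    exact ⟨v, by rw [mem_compl, mem_below]; omega⟩
  have hzero : below l 0 = ∅ := by
    ext v
    simp [mem_below]
  have htop : below l (k + 2) = univ := by
    ext v
    have := h.le v
    simp only [mem_below, mem_univ, iff_true]
    omega
  rcases Nat.eq_zero_or_pos i with rfl | hi
  · rw [hzero, sdiff_empty]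
    rcases hj.eq_or_lt with rfl | hj
    · rw [htop, deficit_univ h.mem]
      exact one_pos
    · have := deficit_add_deficit_compl h.mem (below l j)
      have := deficit_nonneg h.mem (hhigh j (by omega))
      have := h.cut_lt j (by omega) (by omega)
      linarith
  · rcases hj.eq_or_lt with rfl | hj
    · rw [htop, ← compl_eq_univ_sdiff]
      have := deficit_add_deficit_compl h.mem (below l i)
      have := deficit_nonneg h.mem (hlow i hi)
      have := h.cut_lt i (by omega) (by omega)
      linarith
    · have := two_mul_deficit_add_two (h.degree_band_eq hi hij.le (by omega))
      have := sum_cut_sdiff_le (G := G) (spanningTreePolytope_bounds h.mem).1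
        (below l i) (below l j)
      have := h.cut_lt i (by omega) (by omega)
      have := h.cut_lt j (by omega) (by omega)
      linarith

theorem exists_adj (h : IsNarrowLevelling G x k l) {U P Q : Finset V} (hU : deficit G x U = 0)
    {i j : ℕ} (hij : i < j) (hj : j ≤ k + 2) (hP : P.Nonempty) (hQ : Q.Nonempty)
    (hPQ : Disjoint P Q) (hunion : P ∪ Q = U ∩ (below l j \ below l i)) :
    ∃ p ∈ P, ∃ q ∈ Q, G.Adj p q := by
  refine exists_adj_of_deficit_lt_one h.mem hP hQ hPQ ?_
  rw [hunion]
  refine (deficit_inter_le h.mem hU ?_).trans_lt (h.deficit_band_lt_one hij hj)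
  rw [← hunion]
  exact hP.mono subset_union_left

theorem exists_level_eq (h : IsNarrowLevelling G x k l) {U : Finset V} (hU : deficit G x U = 0)
    {u v : V} (hu : u ∈ U) (hv : v ∈ U) {m : ℕ} (hum : l u < m) (hmv : m < l v) :
    ∃ w ∈ U, l w = m := by
  by_contra! hm
  have hmk : m ≤ k := by have := h.le v; omega
  have hdisj : Disjoint U (below l (m + 1) \ below l m) := by
    rw [disjoint_left]
    intro w hw
    have := hm w hw
    simp only [mem_sdiff, mem_below]
    omega
  have hsub : below l m ⊆ below l (m + 1) := fun w hw => by
    rw [mem_below] at *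
    omega
  have h₁ := sum_cut_sdiff_add_le (G := G) (spanningTreePolytope_bounds h.mem).1 hsub hdisj
  have h₂ := two_mul_deficit_add_two (h.degree_eq m (by omega) hmk)
  have hne : (below l (m + 1) \ below l m).Nonempty := by
    obtain ⟨w, hw⟩ := h.exists_eq m (by omega)
    exact ⟨w, by simp only [mem_sdiff, mem_below]; omega⟩
  have h₃ := deficit_nonneg h.mem hne
  have h₄ := h.cut_lt m (by omega) (by omega)
  have h₅ := h.cut_lt (m + 1) (by omega) (by omega)
  have h₆ := deficit_nonneg h.mem (S := U ∩ below l m)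
    ⟨u, mem_inter.2 ⟨hu, mem_below.2 hum⟩⟩
  have h₇ := deficit_nonneg h.mem (S := U \ below l m)
    ⟨v, mem_sdiff.2 ⟨hv, by rw [mem_below]; omega⟩⟩
  have h₈ : ((U \ below l m).card : ℝ) + ((U ∩ below l m).card : ℝ) = U.card := by
    exact_mod_cast card_sdiff_add_card_inter U (below l m)
  unfold deficit at *
  linarith

theorem exists_adj_succ (h : IsNarrowLevelling G x k l) {U : Finset V} (hU : deficit G x U = 0)
    {i : ℕ} (hi : i ≤ k) (h₀ : ∃ u ∈ U, l u = i) (h₁ : ∃ u ∈ U, l u = i + 1) :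
    ∃ a ∈ U, ∃ b ∈ U, G.Adj a b ∧ l a = i ∧ l b = i + 1 := by
  obtain ⟨u, hu, hui⟩ := h₀
  obtain ⟨v, hv, hvi⟩ := h₁
  obtain ⟨a, ha, b, hb, hab⟩ := h.exists_adj (P := U.filter fun w => l w = i)
    (Q := U.filter fun w => l w = i + 1) hU (show i < i + 2 by omega) (by omega)
    ⟨u, mem_filter.2 ⟨hu, hui⟩⟩ ⟨v, mem_filter.2 ⟨hv, hvi⟩⟩
    (by
      rw [disjoint_left]
      intro w
      simp only [mem_filter]
      omega)
    (by
      ext w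
      simp only [mem_union, mem_filter, mem_inter, mem_sdiff, mem_below, ← and_or_left]
      exact and_congr_right fun _ => by omega)
  rw [mem_filter] at ha hb
  exact ⟨a, ha.1, b, hb.1, hab, ha.2, hb.2⟩

theorem reachable_of_level_eq (h : IsNarrowLevelling G x k l) {U : Finset V}
    (hU : deficit G x U = 0) {K : SimpleGraph V}
    (hK : ∀ u ∈ U, ∀ v ∈ U, G.Adj u v → l u = l v → K.Adj u v)
    {u v : V} (hu : u ∈ U) (hv : v ∈ U) (huv : l u = l v) : K.Reachable u v := by
  by_contra hnot
  have := h.le u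
  obtain ⟨p, hp, q, hq, hpq⟩ := h.exists_adj
    (P := U.filter fun w => l w = l u ∧ K.Reachable u w)
    (Q := U.filter fun w => l w = l u ∧ ¬ K.Reachable u w) hU
    (show l u < l u + 1 by omega) (by omega)
    ⟨u, mem_filter.2 ⟨hu, rfl, .rfl⟩⟩ ⟨v, mem_filter.2 ⟨hv, huv.symm, hnot⟩⟩
    (by
      rw [disjoint_left]
      intro w
      simp only [mem_filter]
      tauto)
    (by
      ext w
      have : l w < l u + 1 ∧ ¬ l w < l u ↔ l w = l u := by omega
      simp only [mem_union, mem_filter, mem_inter, mem_sdiff, mem_below, this]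
      tauto)
  rw [mem_filter] at hp hq
  exact hq.2.2 (hp.2.2.trans (hK p hp.1 q hq.1 hpq (hp.2.1.trans hq.2.1.symm)).reachable)

theorem reachable (h : IsNarrowLevelling G x k l) {U : Finset V}
    (hU : deficit G x U = 0) {K : SimpleGraph V}
    (hK : ∀ u ∈ U, ∀ v ∈ U, G.Adj u v → l u = l v → K.Adj u v)
    (hK' : ∀ i ≤ k, (∃ u ∈ U, l u = i) → (∃ u ∈ U, l u = i + 1) →
      ∃ a ∈ U, ∃ b ∈ U, K.Adj a b ∧ l a = i ∧ l b = i + 1)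
    {u v : V} (hu : u ∈ U) (hv : v ∈ U) : K.Reachable u v := by
  wlog huv : l u ≤ l v generalizing u v
  · exact (this hv hu (by omega)).symm
  obtain ⟨j, hj⟩ : ∃ j, l v = j := ⟨_, rfl⟩
  rw [hj] at huv
  induction j, huv using Nat.le_induction generalizing v with
  | base => exact h.reachable_of_level_eq hU hK hu hv hj.symm
  | succ j huj ih =>
    have hlev : ∃ w ∈ U, l w = j := by
      rcases huj.eq_or_lt with huj | huj
      · exact ⟨u, hu, huj⟩
      · exact h.exists_level_eq hU hu hv huj (by omega)
    have := h.le v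
    obtain ⟨a, ha, b, hb, hab, haj, hbj⟩ := hK' j (by omega) hlev ⟨v, hv, hj⟩
    exact ((ih ha haj).trans hab.reachable).trans
      (h.reachable_of_level_eq hU hK hb hv (hbj.trans hj.symm))

theorem exists_crossing_edges (h : IsNarrowLevelling G x k l) {U : Finset V}
    (hU : deficit G x U = 0) :
    ∃ a b : ℕ → V, ∀ i ≤ k, G.Adj (a i) (b i) ∧ l (a i) = i ∧ l (b i) = i + 1 ∧
      ((∃ u ∈ U, l u = i) → (∃ u ∈ U, l u = i + 1) → a i ∈ U ∧ b i ∈ U) := by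
  have key : ∀ i, ∃ a b : V, i ≤ k → G.Adj a b ∧ l a = i ∧ l b = i + 1 ∧
      ((∃ u ∈ U, l u = i) → (∃ u ∈ U, l u = i + 1) → a ∈ U ∧ b ∈ U) := by
    intro i
    by_cases hi : i ≤ k
    · by_cases hi' : (∃ u ∈ U, l u = i) ∧ ∃ u ∈ U, l u = i + 1
      · obtain ⟨a, ha, b, hb, hab⟩ := h.exists_adj_succ hU hi hi'.1 hi'.2
        exact ⟨a, b, fun _ => ⟨hab.1, hab.2.1, hab.2.2, fun _ _ => ⟨ha, hb⟩⟩⟩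
      · obtain ⟨u, hu⟩ := h.exists_eq i (by omega)
        obtain ⟨v, hv⟩ := h.exists_eq (i + 1) (by omega)
        obtain ⟨a, -, b, -, hab⟩ := h.exists_adj_succ (deficit_univ h.mem) hi
          ⟨u, mem_univ u, hu⟩ ⟨v, mem_univ v, hv⟩
        exact ⟨a, b, fun _ => ⟨hab.1, hab.2.1, hab.2.2, fun h₀ h₁ => absurd ⟨h₀, h₁⟩ hi'⟩⟩
    · obtain ⟨u, -⟩ := h.exists_eq 0 (by omega)
      exact ⟨u, u, fun hk => absurd hk hi⟩
  choose a b hab using key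
  exact ⟨a, b, hab⟩

end IsNarrowLevelling

theorem exists_level_function {W : Type*} {Vc : ℕ → Finset W} {k : ℕ}
    (hchain : ∀ i < k, Vc i ⊂ Vc (i + 1)) :
    ∃ l : W → ℕ, (∀ v, l v ≤ k + 1) ∧ ∀ i ≤ k, ∀ v, v ∈ Vc i ↔ l v ≤ i := by
  have hmono : ∀ i j, i ≤ j → j ≤ k → Vc i ⊆ Vc j := by
    intro i j hij
    induction j, hij using Nat.le_induction with
    | base => exact fun _ => Subset.refl _
    | succ j hij ih => exact fun hj => (ih (by omega)).trans (hchain j (by omega)).1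
  have key : ∀ v, ∃ n ≤ k + 1, ∀ i ≤ k, v ∈ Vc i ↔ n ≤ i := by
    intro v
    by_cases hv : ∃ i, i ≤ k ∧ v ∈ Vc i
    · refine ⟨Nat.find hv, (Nat.find_spec hv).1.trans (Nat.le_succ k), fun i hi => ?_⟩
      exact ⟨fun hvi => Nat.find_min' hv ⟨hi, hvi⟩,
        fun hle => hmono _ _ hle hi (Nat.find_spec hv).2⟩
    · refine ⟨k + 1, le_rfl, fun i hi => ⟨fun hvi => absurd ⟨i, hi, hvi⟩ hv, fun _ => ?_⟩⟩
      omega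
  choose l hl hl' using key
  exact ⟨l, hl, fun i hi v => hl' v i hi⟩

theorem below_succ_eq {Vc : ℕ → Finset V} {k : ℕ} {l : V → ℕ}
    (hl : ∀ i ≤ k, ∀ v, v ∈ Vc i ↔ l v ≤ i) {i : ℕ} (hi : i ≤ k) : below l (i + 1) = Vc i := by
  ext v
  rw [mem_below, hl i hi]
  omega

theorem IsChainPoint.isNarrowLevelling {G : SimpleGraph V} {Vc : ℕ → Finset V} {k : ℕ}
    {x : Sym2 V → ℝ} (hx : IsChainPoint G Vc k x) (hne : (Vc 0).Nonempty)
    (hchain : ∀ i < k, Vc i ⊂ Vc (i + 1)) (htop : Vc k ⊂ univ) {l : V → ℕ}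
    (hle : ∀ v, l v ≤ k + 1) (hl : ∀ i ≤ k, ∀ v, v ∈ Vc i ↔ l v ≤ i) :
    IsNarrowLevelling G x k l := by
  obtain ⟨hmem, h0, hk, hcut, hdeg⟩ := hx
  refine ⟨hmem, hle, fun j hj => ?_, fun j hj hj' => ?_, fun j hj hj' => ?_⟩
  · rcases Nat.eq_zero_or_pos j with rfl | hj0
    · obtain ⟨v, hv⟩ := hne
      exact ⟨v, by simpa using (hl 0 (by omega) v).1 hv⟩
    · obtain ⟨i, rfl⟩ : ∃ i, j = i + 1 := ⟨j - 1, by omega⟩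
      rcases hj.eq_or_lt with hj | hj
      · obtain rfl : i = k := by omega
        obtain ⟨v, -, hv⟩ := exists_of_ssubset htop
        rw [hl i le_rfl] at hv
        have := hle v
        exact ⟨v, by omega⟩
      · obtain ⟨v, hv, hv'⟩ := exists_of_ssubset (hchain i (by omega))
        rw [hl _ (by omega)] at hv hv'
        exact ⟨v, by omega⟩
  · obtain ⟨i, rfl⟩ : ∃ i, j = i + 1 := ⟨j - 1, by omega⟩
    rw [below_succ_eq hl (by omega)]
    rcases Nat.eq_zero_or_pos i with rfl | hi
    · rw [h0]
      norm_num
    · rcases (show i ≤ k by omega).eq_or_lt with rfl | hik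
      · rw [hk]
        norm_num
      · exact hcut i hi (by omega)
  · have hlev : level Vc k j = below l (j + 1) \ below l j := by
      obtain ⟨i, rfl⟩ : ∃ i, j = i + 1 := ⟨j - 1, by omega⟩
      rw [below_succ_eq hl hj', below_succ_eq hl (by omega), level, if_neg (by omega), if_pos hj',
        Nat.add_sub_cancel]
    rw [← hlev]
    exact hdeg j hj hj'

end Levels

section LevelTree

variable {G : SimpleGraph V}

/-- The edges of `G` inside the levels of `l`, together with the edges `a i — b i`. -/
def levelGraph (G : SimpleGraph V) (l : V → ℕ) (k : ℕ) (a b : ℕ → V) : SimpleGraph V where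
  Adj u v := G.Adj u v ∧ (l u = l v ∨ ∃ i ≤ k, s(u, v) = s(a i, b i))
  symm := ⟨fun _ _ h => ⟨h.1.symm, h.2.imp Eq.symm fun ⟨i, hi, he⟩ =>
    ⟨i, hi, Sym2.eq_swap.trans he⟩⟩⟩
  loopless := ⟨fun _ h => h.1.ne rfl⟩

theorem card_inter_cut_of_le_levelGraph {l : V → ℕ} {k : ℕ} {a b : ℕ → V}
    (ha : ∀ i ≤ k, l (a i) = i) (hb : ∀ i ≤ k, l (b i) = i + 1) {T : SimpleGraph V}
    (hT : T.Connected) (hTH : T ≤ levelGraph G l k a b) {i : ℕ} (hi : i ≤ k) :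
    (T.edgeFinset ∩ cut G (below l (i + 1))).card = 1 := by
  have hcross : ∀ u v, T.Adj u v → l u < i + 1 → ¬ l v < i + 1 → s(u, v) = s(a i, b i) := by
    intro u v huv hu hv
    rcases (hTH huv).2 with h | ⟨j, hj, h⟩
    · omega
    · have h₁ := ha j hj
      have h₂ := hb j hj
      suffices i = j from this ▸ h
      rcases Sym2.eq_iff.1 h with ⟨rfl, rfl⟩ | ⟨rfl, rfl⟩ <;> omega
  rw [card_eq_one]
  refine ⟨s(a i, b i), eq_singleton_iff_unique_mem.2 ⟨?_, ?_⟩⟩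
  · obtain ⟨p⟩ := hT.preconnected (a i) (b i)
    have := ha i hi
    have := hb i hi
    obtain ⟨d, -, hd₁, hd₂⟩ := p.exists_boundary_dart {v | l v < i + 1}
      (show l (a i) < i + 1 by omega) (show ¬ l (b i) < i + 1 by omega)
    rw [← hcross _ _ d.adj hd₁ hd₂, mem_inter, mem_cut_mk, SimpleGraph.mem_edgeFinset]
    exact ⟨d.adj, (hTH d.adj).1, .inl ⟨mem_below.2 hd₁, fun h => hd₂ (mem_below.1 h)⟩⟩
  · intro e he
    induction e with | _ u v
    simp only [mem_inter, mem_cut_mk, mem_below, SimpleGraph.mem_edgeFinset,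
      SimpleGraph.mem_edgeSet] at he
    obtain ⟨huv, -, ⟨h₁, h₂⟩ | ⟨h₁, h₂⟩⟩ := he
    · exact hcross u v huv h₁ h₂
    · rw [Sym2.eq_swap]
      exact hcross v u huv.symm h₁ h₂

theorem SimpleGraph.Reachable.induce_of_adj_mem {W : Type*} {F : SimpleGraph W} {s : Set W}
    (hF : ∀ u v, F.Adj u v → v ∈ s) {u v : W} (hu : u ∈ s) (hv : v ∈ s) (h : F.Reachable u v) :
    (F.induce s).Reachable ⟨u, hu⟩ ⟨v, hv⟩ := by
  by_contra hnot
  obtain ⟨p⟩ := h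
  obtain ⟨d, -, ⟨hd, hr⟩, hd₂⟩ := p.exists_boundary_dart
    {w | ∃ hw : w ∈ s, (F.induce s).Reachable ⟨u, hu⟩ ⟨w, hw⟩} ⟨hu, .rfl⟩ (fun ⟨_, h⟩ => hnot h)
  refine hd₂ ⟨hF _ _ d.adj, hr.trans (SimpleGraph.Adj.reachable ?_)⟩
  exact d.adj

theorem isSpanningTreeOfInduced_inducedEdges {T F : SimpleGraph V} {U : Finset V}
    (hT : T.IsAcyclic) (hTG : T ≤ G) (hFT : F ≤ T) (hU : U.Nonempty)
    (hFU : ∀ u v, F.Adj u v → v ∈ U)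
    (hF : ∀ u ∈ U, ∀ v ∈ U, F.Reachable u v) :
    IsSpanningTreeOfInduced G U (inducedEdges T U) := by
  refine ⟨fun e he => ?_, fun e he => ?_, ?_, fun u hu v hv => (hF u hu v hv).mono ?_⟩
  · rw [mem_coe, inducedEdges, mem_filter, SimpleGraph.mem_edgeFinset] at he
    exact SimpleGraph.edgeSet_mono hTG he.1
  · rw [inducedEdges, mem_filter] at he
    exact he.2
  · have : Nonempty (U : Set V) := hU.to_subtype
    have htree : (T.induce (U : Set V)).IsTree := by
      refine ⟨⟨fun u v => ?_⟩, hT.induce _⟩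
      exact ((hF u u.2 v v.2).induce_of_adj_mem (s := (U : Set V)) hFU u.2 v.2).mono
        fun _ _ h => hFT h
    have hcard := htree.card_edgeFinset
    rw [card_inducedEdges]
    have hcardU : Fintype.card (U : Set V) = U.card := by simp
    rw [← hcardU, ← hcard, Nat.add_sub_cancel]
  · intro u v huv
    rw [SimpleGraph.fromEdgeSet_adj]
    exact ⟨mem_inducedEdges_mk.2 ⟨hFT huv, hFU v u huv.symm, hFU u v huv⟩, huv.ne⟩

end LevelTree

theorem stmt4 (G : SimpleGraph V) (hG : G.Connected)
    (Vc : ℕ → Finset V) (k : ℕ)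
    (hne : (Vc 0).Nonempty) (hchain : ∀ i < k, Vc i ⊂ Vc (i + 1))
    (htop : Vc k ⊂ Finset.univ)
    (x : Sym2 V → ℝ) (hx : IsChainPoint G Vc k x)
    (U : Finset V) (hU : (∑ e ∈ inducedEdges G U, x e) = (U.card : ℝ) - 1) :
    ∃ T : Finset (Sym2 V), IsGaoTree G Vc k T ∧
      IsSpanningTreeOfInduced G U (T ∩ inducedEdges G U) := by
  obtain ⟨l, hle, hl⟩ := exists_level_function hchain
  have h := hx.isNarrowLevelling hne hchain htop hle hl
  have hU₀ : deficit G x U = 0 := sub_eq_zero.2 hU.symm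
  have hUne : U.Nonempty := by
    by_contra hempty
    rw [not_nonempty_iff_eq_empty] at hempty
    subst hempty
    have := sum_nonneg fun e (_ : e ∈ inducedEdges G ∅) => (spanningTreePolytope_bounds hx.1).1 e
    rw [hU] at this
    norm_num at this
  obtain ⟨a, b, hab⟩ := h.exists_crossing_edges hU₀
  have hadj : ∀ i ≤ k, (levelGraph G l k a b).Adj (a i) (b i) := fun i hi =>
    ⟨(hab i hi).1, .inr ⟨i, hi, rfl⟩⟩
  have hH : (levelGraph G l k a b).Connected := by
    have := hG.nonempty
    refine ⟨fun u v => h.reachable (deficit_univ h.mem) (K := levelGraph G l k a b)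
      (fun u _ v _ huv hl => ⟨huv, .inl hl⟩)
      (fun i hi _ _ => ?_) (mem_univ u) (mem_univ v)⟩
    exact ⟨a i, mem_univ _, b i, mem_univ _, hadj i hi, (hab i hi).2.1, (hab i hi).2.2.1⟩
  let K : SimpleGraph V := ((levelGraph G l k a b).induce (U : Set V)).spanningCoe
  have hK : ∀ u v, K.Adj u v ↔ u ∈ U ∧ v ∈ U ∧ (levelGraph G l k a b).Adj u v := by
    intro u v
    simp only [K, SimpleGraph.map_adj, SimpleGraph.comap_adj, Subtype.exists,
      Function.Embedding.subtype_apply, mem_coe]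
    constructor
    · rintro ⟨u', hu, v', hv, huv, rfl, rfl⟩
      exact ⟨hu, hv, huv⟩
    · rintro ⟨hu, hv, huv⟩
      exact ⟨u, hu, v, hv, huv, rfl, rfl⟩
  have hKreach : ∀ u ∈ U, ∀ v ∈ U, K.Reachable u v := by
    refine fun u hu v hv => h.reachable hU₀
      (fun u hu v hv huv hl => (hK u v).2 ⟨hu, hv, huv, .inl hl⟩) (fun i hi h₀ h₁ => ?_) hu hv
    obtain ⟨-, hai, hbi, hmem⟩ := hab i hi
    obtain ⟨haU, hbU⟩ := hmem h₀ h₁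
    exact ⟨a i, haU, b i, hbU, (hK _ _).2 ⟨haU, hbU, hadj i hi⟩, hai, hbi⟩
  obtain ⟨F, hFK, hFacyc, hFreach⟩ := K.exists_isAcyclic_reachable_eq_le
  obtain ⟨T, hFT, hTH, hT⟩ := hH.exists_isTree_le_of_le_of_isAcyclic
    (fun u v huv => ((hK u v).1 (hFK huv)).2.2) hFacyc
  have hTG : T ≤ G := fun u v huv => (hTH huv).1
  refine ⟨T.edgeFinset, ⟨⟨?_, ?_⟩, fun i hi => ?_⟩, ?_⟩
  · rw [SimpleGraph.coe_edgeFinset]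
    exact SimpleGraph.edgeSet_mono hTG
  · rwa [SimpleGraph.coe_edgeFinset, SimpleGraph.fromEdgeSet_edgeSet]
  · rw [← below_succ_eq hl hi]
    exact card_inter_cut_of_le_levelGraph (fun i hi => (hab i hi).2.1)
      (fun i hi => (hab i hi).2.2.1) hT.connected hTH hi
  · have hinter : T.edgeFinset ∩ inducedEdges G U = inducedEdges T U := by
      ext e
      induction e with | _ u v
      simp only [mem_inter, mem_inducedEdges_mk, SimpleGraph.mem_edgeFinset,
        SimpleGraph.mem_edgeSet]
      exact ⟨fun h => ⟨h.1, h.2.2⟩, fun h => ⟨h.1, hTG h.1, h.2⟩⟩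
    rw [hinter]
    refine isSpanningTreeOfInduced_inducedEdges hT.isAcyclic hTG hFT hUne
      (fun u v huv => ((hK u v).1 (hFK huv)).2.1) fun u hu v hv => ?_
    rw [hFreach]
    exact hKreach u hu v hv
end
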